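/- arXiv:1810.01131 — 2 statements merged into one kernel-verified Lean document; each statement's English description precedes it below -/
import Mathlib

section
/- For every n ≥ 3 and g ∈ ℕ, the residue classes of the elements U_{k₂,…,kₙ} with (k₂,…,kₙ) ⪰ 𝐧 and 2k₂+3k₃+⋯+nkₙ = g form a ℂ-basis of the quotient S_{n,g}/Dec_{n,g}. -/
open MvPolynomial TensorProduct

noncomputable section

/-- The potenziante `π_{n,g} = ∑_{r₁+⋯+rₙ=g} λ₁^{r₁}⋯λₙ^{rₙ} ⊗ a_{r₁}⋯a_{rₙ}`
as an element of `ℂ[λ₁,…,λₙ] ⊗_ℂ R`, where `R = ℂ[a₀,a₁,…] = MvPolynomial ℕ ℂ`. -/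
def pot (n g : ℕ) : MvPolynomial (Fin n) ℂ ⊗[ℂ] MvPolynomial ℕ ℂ :=
  ∑ r ∈ Finset.Nat.antidiagonalTuple n g,
    (∏ i : Fin n, X i ^ r i) ⊗ₜ[ℂ] (∏ i : Fin n, X (r i))

/-- The tuples `(k₁,…,kₙ) ∈ ℕⁿ` with `k₁ + 2k₂ + ⋯ + nkₙ = g`. -/
def wtT (n g : ℕ) : Finset (Fin n → ℕ) :=
  (Fintype.piFinset fun _ : Fin n => Finset.range (g + 1)).filter
    (fun k => ∑ i : Fin n, ((i : ℕ) + 1) * k i = g)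

/-- `(k₂,…,kₙ) ↦ (0,k₂,…,kₙ)`. -/
def extend0 {n : ℕ} (k : Fin (n - 1) → ℕ) : Fin n → ℕ :=
  fun i => if h : 0 < (i : ℕ) then k ⟨(i : ℕ) - 1, by have := i.isLt; omega⟩ else 0

/-- `R_{n,g}`: the ℂ-span of the monomials of degree `n` and weight `g` in
`R = ℂ[a₀,a₁,…] = MvPolynomial ℕ ℂ` (with `aᵢ = X i`). -/
def Rng (n g : ℕ) : Submodule ℂ (MvPolynomial ℕ ℂ) :=
  Submodule.span ℂ {p : MvPolynomial ℕ ℂ | ∃ m : ℕ →₀ ℕ,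
    (m.sum fun _ e => e) = n ∧ (m.sum fun i e => i * e) = g ∧ p = monomial m 1}

/-- `S_{n,g} = (ker D) ∩ R_{n,g}`: the `U`-invariants of degree `n` and weight `g`. -/
def Sng (D : Derivation ℂ (MvPolynomial ℕ ℂ) (MvPolynomial ℕ ℂ)) (n g : ℕ) :
    Submodule ℂ (MvPolynomial ℕ ℂ) :=
  LinearMap.ker (D : MvPolynomial ℕ ℂ →ₗ[ℂ] MvPolynomial ℕ ℂ) ⊓ Rng n g

/-- `Dec_{n,g} = ∑_{h=1}^{n-1} ∑_{j=0}^{g} S_{h,j}·S_{n-h,g-j}`: the decomposable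
`U`-invariants of degree `n` and weight `g`. -/
def Dec (D : Derivation ℂ (MvPolynomial ℕ ℂ) (MvPolynomial ℕ ℂ)) (n g : ℕ) :
    Submodule ℂ (MvPolynomial ℕ ℂ) :=
  ⨆ h ∈ Finset.Icc 1 (n - 1), ⨆ j ∈ Finset.range (g + 1),
    Sng D h j * Sng D (n - h) (g - j)

/-- The tuple `𝐧 = (0, 2^{n-4}, 2^{n-5}, …, 2, 1, 1) ∈ ℕ^{n-1}` (for `n > 3`),
resp. `𝐧 = (0,1)` for `n = 3`: indexed by `(h₂,…,hₙ)`, `h₂ = 0`,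
`hⱼ = 2^{n-j-1}` for `3 ≤ j ≤ n-1`, `hₙ = 1`. -/
def nvec (n : ℕ) : Fin (n - 1) → ℕ :=
  fun i => if (i : ℕ) = 0 then 0
    else if (i : ℕ) = n - 2 then 1 else 2 ^ (n - (i : ℕ) - 3)

theorem Derivation.leibniz_finset_prod {R A M ι : Type*} [CommSemiring R] [CommSemiring A]
    [AddCommMonoid M] [Algebra R A] [Module A M] [Module R M] [DecidableEq ι]
    (D : Derivation R A M) (s : Finset ι) (f : ι → A) :
    D (∏ i ∈ s, f i) = ∑ i ∈ s, (∏ j ∈ s.erase i, f j) • D (f i) := by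
  induction s using Finset.induction_on with
  | empty => simp
  | insert a s ha ih =>
    rw [Finset.prod_insert ha, Finset.sum_insert ha, D.leibniz, ih, Finset.erase_insert ha,
      add_comm, Finset.smul_sum]
    congr 1
    refine Finset.sum_congr rfl fun i hi => ?_
    have hne : a ≠ i := by rintro rfl; exact ha hi
    rw [Finset.erase_insert_of_ne hne, Finset.prod_insert (by simp [ha]), smul_smul]

/-- The monomial `a_{r₁}⋯a_{rₙ}`. -/
def tupleMonomial {n : ℕ} (r : Fin n →₀ ℕ) : MvPolynomial ℕ ℂ := ∏ i, X (r i)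

theorem tupleMonomial_eq_monomial {n : ℕ} (r : Fin n →₀ ℕ) :
    tupleMonomial r = monomial (∑ i, Finsupp.single (r i) 1) 1 := by
  rw [tupleMonomial, monomial_sum_one]
  rfl

theorem tupleMonomial_mem_Rng {n : ℕ} (r : Fin n →₀ ℕ) : tupleMonomial r ∈ Rng n (∑ i, r i) := by
  refine Submodule.subset_span ⟨_, ?_, ?_, tupleMonomial_eq_monomial r⟩
  · rw [← Finsupp.sum_finsetSum_index (by simp) (by simp)]
    simp
  · rw [← Finsupp.sum_finsetSum_index (by simp) (by intros; ring)]
    simp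

theorem exists_tuple_of_sum_eq {n : ℕ} (m : ℕ →₀ ℕ) (hm : (m.sum fun _ e => e) = n) :
    ∃ r : Fin n →₀ ℕ, ∑ i, Finsupp.single (r i) 1 = m := by
  have hc : (Finsupp.toMultiset m).toList.length = n := by
    rw [Multiset.length_toList, Finsupp.card_toMultiset, ← hm]
    rfl
  subst hc
  refine ⟨Finsupp.equivFunOnFinite.symm fun i => (Finsupp.toMultiset m).toList.get i, ?_⟩
  apply Multiset.toFinsupp.symm.injective
  rw [Multiset.toFinsupp_symm_apply, Multiset.toFinsupp_symm_apply]
  rw [map_sum]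
  simp only [Finsupp.toMultiset_single, one_smul, Finsupp.coe_equivFunOnFinite_symm]
  have h := Fin.sum_univ_fun_getElem (Finsupp.toMultiset m).toList
    (fun a => ({a} : Multiset ℕ))
  simp only [List.get_eq_getElem]
  rw [h, ← Multiset.sum_coe, ← Multiset.map_coe, Multiset.sum_map_singleton, Multiset.coe_toList]

theorem exists_perm_of_sum_single_eq {ι : Type*} [Fintype ι] (r s : ι → ℕ)
    (h : ∑ i, Finsupp.single (r i) 1 = ∑ i, Finsupp.single (s i) 1) :
    ∃ σ : Equiv.Perm ι, ∀ i, s (σ i) = r i := by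
  classical
  have hcard (f : ι → ℕ) (c : ℕ) :
      (∑ i, Finsupp.single (f i) 1) c = Fintype.card {i // f i = c} := by
    rw [Finsupp.finsetSum_apply, Fintype.card_subtype, Finset.card_filter]
    exact Finset.sum_congr rfl fun i _ => by rw [Finsupp.single_apply]
  have e (c : ℕ) : {i // r i = c} ≃ {i // s i = c} :=
    Fintype.equivOfCardEq (by rw [← hcard, ← hcard, h])
  exact ⟨Equiv.ofFiberEquiv e, Equiv.ofFiberEquiv_map e⟩

/-- The functional on `R` that sends `a_{r₁}⋯a_{rₙ}` to the coefficient of `λ₁^{r₁}⋯λₙ^{rₙ}`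
in a symmetric polynomial, and kills the monomials of degree different from `n`. -/
def coeffFunctional {n : ℕ} (F : MvPolynomial (Fin n) ℂ) : MvPolynomial ℕ ℂ →ₗ[ℂ] ℂ :=
  open Classical in
  (basisMonomials ℕ ℂ).constr ℂ fun m =>
    if h : ∃ r : Fin n →₀ ℕ, ∑ i, Finsupp.single (r i) 1 = m then coeff h.choose F else 0

theorem coeffFunctional_tupleMonomial {n : ℕ} {F : MvPolynomial (Fin n) ℂ} (hF : F.IsSymmetric)
    (r : Fin n →₀ ℕ) : coeffFunctional F (tupleMonomial r) = coeff r F := by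
  have h : ∃ s : Fin n →₀ ℕ,
      ∑ i, Finsupp.single (s i) 1 = ∑ i, Finsupp.single (r i) 1 := ⟨r, rfl⟩
  have hb := (basisMonomials ℕ ℂ).constr_basis ℂ (fun m =>
    open Classical in
    if h : ∃ r : Fin n →₀ ℕ, ∑ i, Finsupp.single (r i) 1 = m then coeff h.choose F else 0)
    (∑ i, Finsupp.single (r i) 1)
  rw [tupleMonomial_eq_monomial, coeffFunctional]
  rw [coe_basisMonomials, dif_pos h] at hb
  rw [hb]
  obtain ⟨σ, hσ⟩ := exists_perm_of_sum_single_eq _ _ h.choose_spec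
  rw [← coeff_rename_mapDomain σ σ.injective, hF σ]
  congr 1
  ext i
  obtain ⟨j, rfl⟩ := σ.surjective i
  rw [Finsupp.mapDomain_apply σ.injective, hσ]

/-- The symmetric polynomial `∑_{r₁+⋯+rₙ=g} ψ(a_{r₁}⋯a_{rₙ}) λ₁^{r₁}⋯λₙ^{rₙ}` obtained by applying
a functional `ψ` to the second factor of the potenziante. -/
def dualPoly (ψ : MvPolynomial ℕ ℂ →ₗ[ℂ] ℂ) (n g : ℕ) : MvPolynomial (Fin n) ℂ :=
  ∑ r ∈ Finset.finsuppAntidiag Finset.univ g, monomial r (ψ (tupleMonomial r))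

/-- The potenziante evaluated at the point `x` in its first factor. -/
def potAt {n : ℕ} (x : Fin n → ℂ) (g : ℕ) : MvPolynomial ℕ ℂ :=
  ∑ r ∈ Finset.finsuppAntidiag Finset.univ g, (∏ i, x i ^ r i) • tupleMonomial r

theorem mem_finsuppAntidiag_univ {n g : ℕ} (r : Fin n →₀ ℕ) :
    r ∈ Finset.finsuppAntidiag Finset.univ g ↔ ∑ i, r i = g := by
  simp [Finset.mem_finsuppAntidiag]

theorem eval_dualPoly (ψ : MvPolynomial ℕ ℂ →ₗ[ℂ] ℂ) {n : ℕ} (g : ℕ) (x : Fin n → ℂ) :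
    eval x (dualPoly ψ n g) = ψ (potAt x g) := by
  rw [dualPoly, potAt, map_sum, map_sum]
  refine Finset.sum_congr rfl fun r _ => ?_
  rw [eval_monomial, map_smul, smul_eq_mul, mul_comm, Finsupp.prod_fintype _ _ (by simp)]

theorem coeff_dualPoly (ψ : MvPolynomial ℕ ℂ →ₗ[ℂ] ℂ) {n : ℕ} (g : ℕ) (r : Fin n →₀ ℕ) :
    coeff r (dualPoly ψ n g) = if ∑ i, r i = g then ψ (tupleMonomial r) else 0 := by
  classical
  rw [dualPoly, coeff_sum]
  simp only [coeff_monomial, Finset.sum_ite_eq', mem_finsuppAntidiag_univ]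

theorem dualPoly_isHomogeneous (ψ : MvPolynomial ℕ ℂ →ₗ[ℂ] ℂ) (n g : ℕ) :
    (dualPoly ψ n g).IsHomogeneous g := by
  refine IsHomogeneous.sum _ _ _ fun r hr => isHomogeneous_monomial _ ?_
  rw [Finsupp.degree_eq_sum, (mem_finsuppAntidiag_univ r).1 hr]

theorem tupleMonomial_mapDomain {n : ℕ} (σ : Equiv.Perm (Fin n)) (r : Fin n →₀ ℕ) :
    tupleMonomial (r.mapDomain σ) = tupleMonomial r := by
  rw [tupleMonomial, tupleMonomial, ← Equiv.prod_comp σ]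
  exact Finset.prod_congr rfl fun i _ => by rw [Finsupp.mapDomain_apply σ.injective]

theorem dualPoly_isSymmetric (ψ : MvPolynomial ℕ ℂ →ₗ[ℂ] ℂ) (n g : ℕ) :
    (dualPoly ψ n g).IsSymmetric := by
  intro σ
  ext r
  obtain ⟨s, rfl⟩ : ∃ s, r = Finsupp.mapDomain σ s :=
    ⟨r.mapDomain σ.symm, by rw [← Finsupp.mapDomain_comp]; simp⟩
  rw [coeff_rename_mapDomain _ σ.injective, coeff_dualPoly, coeff_dualPoly,
    tupleMonomial_mapDomain, ← Equiv.sum_comp σ (Finsupp.mapDomain σ s)]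
  simp only [Finsupp.mapDomain_apply σ.injective]

theorem dualPoly_coeffFunctional {n g : ℕ} {F : MvPolynomial (Fin n) ℂ} (hF : F.IsSymmetric)
    (hg : F.IsHomogeneous g) : dualPoly (coeffFunctional F) n g = F := by
  ext r
  rw [coeff_dualPoly, coeffFunctional_tupleMonomial hF]
  split_ifs with h
  · rfl
  · exact (hg.coeff_eq_zero (by rwa [Finsupp.degree_eq_sum])).symm

theorem potAt_smul {n : ℕ} (t : ℂ) (x : Fin n → ℂ) (g : ℕ) :
    potAt (t • x) g = t ^ g • potAt x g := by
  rw [potAt, potAt, Finset.smul_sum]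
  refine Finset.sum_congr rfl fun r hr => ?_
  simp only [Pi.smul_apply, smul_eq_mul, mul_pow, Finset.prod_mul_distrib, smul_smul]
  rw [Finset.prod_pow_eq_pow_sum, (mem_finsuppAntidiag_univ r).1 hr]

theorem potAt_mem_Rng {n : ℕ} (x : Fin n → ℂ) (g : ℕ) : potAt x g ∈ Rng n g := by
  refine Submodule.sum_mem _ fun r hr => Submodule.smul_mem _ _ ?_
  rw [← (mem_finsuppAntidiag_univ r).1 hr]
  exact tupleMonomial_mem_Rng r

theorem Rng_le_span (n g : ℕ) :
    Rng n g ≤ Submodule.span ℂ {p | ∃ r : Fin n →₀ ℕ, ∑ i, r i = g ∧ p = tupleMonomial r} := by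
  refine Submodule.span_le.2 ?_
  rintro _ ⟨m, hm, hg, rfl⟩
  obtain ⟨r, rfl⟩ := exists_tuple_of_sum_eq m hm
  refine Submodule.subset_span ⟨r, ?_, (tupleMonomial_eq_monomial r).symm⟩
  rw [← Finsupp.sum_finsetSum_index (by simp) (by intros; ring)] at hg
  simpa using hg

/-- The power series `∑ᵣ tʳ aᵣ Tʳ`. -/
def genSeries (t : ℂ) : PowerSeries (MvPolynomial ℕ ℂ) := PowerSeries.mk fun r => t ^ r • X r

theorem coeff_prod_genSeries {n : ℕ} (x : Fin n → ℂ) (g : ℕ) :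
    PowerSeries.coeff g (∏ i, genSeries (x i)) = potAt x g := by
  rw [PowerSeries.coeff_prod, potAt]
  refine Finset.sum_congr rfl fun r _ => ?_
  simp only [genSeries, PowerSeries.coeff_mk]
  rw [Finset.prod_smul, tupleMonomial]

theorem potAt_append {a b : ℕ} (x : Fin a → ℂ) (y : Fin b → ℂ) (g : ℕ) :
    potAt (Fin.append x y) g =
      ∑ p ∈ Finset.HasAntidiagonal.antidiagonal g, potAt x p.1 * potAt y p.2 := by
  rw [← coeff_prod_genSeries, Fin.prod_univ_add, PowerSeries.coeff_mul]
  simp only [Fin.append_left, Fin.append_right, coeff_prod_genSeries]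

theorem potAt_eq_sum_compl {n : ℕ} (x : Fin n → ℂ) (A : Finset (Fin n)) (g : ℕ) :
    potAt x g = ∑ p ∈ Finset.HasAntidiagonal.antidiagonal g,
      potAt (fun i => x (A.equivFin.symm i)) p.1 * potAt (fun i => x (Aᶜ.equivFin.symm i)) p.2 := by
  have h (B : Finset (Fin n)) (k : ℕ) :
      PowerSeries.coeff k (∏ i ∈ B, genSeries (x i)) =
        potAt (fun i => x (B.equivFin.symm i)) k := by
    rw [← coeff_prod_genSeries, Equiv.prod_comp B.equivFin.symm (fun i => genSeries (x i)),
      Finset.prod_coe_sort B (fun i => genSeries (x i))]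
  rw [← coeff_prod_genSeries, ← Finset.prod_mul_prod_compl A, PowerSeries.coeff_mul]
  simp only [h]

section LinearForm

variable {ι : Type*}

/-- The linear form `∑_{i ∈ A} X i`. -/
def linForm (A : Finset ι) : MvPolynomial ι ℂ := ∑ i ∈ A, X i

theorem eval_linForm (A : Finset ι) (x : ι → ℂ) : eval x (linForm A) = ∑ i ∈ A, x i := by
  simp [linForm]

theorem exists_algHom_linForm_dvd_iff {A : Finset ι} (hA : A.Nonempty) :
    ∃ φ : MvPolynomial ι ℂ →ₐ[ℂ] MvPolynomial ι ℂ,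
      (∀ f, linForm A ∣ f ↔ φ f = 0) ∧
      ∀ f, (∀ x : ι → ℂ, ∑ i ∈ A, x i = 0 → eval x f = 0) → φ f = 0 := by
  classical
  obtain ⟨a, ha⟩ := hA
  let s : ι → MvPolynomial ι ℂ := fun i => if i = a then X a - linForm A else X i
  have hs : ∑ i ∈ A, s i = 0 := by
    rw [← Finset.add_sum_erase _ _ ha]
    have h1 : ∑ i ∈ A.erase a, s i = ∑ i ∈ A.erase a, X i :=
      Finset.sum_congr rfl fun i hi => if_neg (Finset.ne_of_mem_erase hi)
    rw [h1, show s a = X a - linForm A from if_pos rfl, linForm, ← Finset.add_sum_erase _ _ ha]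
    ring
  have hφ : aeval s (linForm A) = 0 := by rw [linForm, map_sum]; simpa using hs
  refine ⟨aeval s, fun f => ⟨?_, fun h => ?_⟩, fun f hf => ?_⟩
  · rintro ⟨g, rfl⟩
    rw [map_mul, hφ, zero_mul]
  · rw [← Ideal.mem_span_singleton]
    let q := Ideal.Quotient.mkₐ ℂ (Ideal.span {linForm A})
    have hq : q.comp (aeval s) = q := by
      ext i
      rw [AlgHom.comp_apply, aeval_X]
      by_cases hi : i = a
      · subst hi
        rw [show s i = X i - linForm A from if_pos rfl, map_sub, sub_eq_self]
        exact Ideal.Quotient.eq_zero_iff_mem.2 (Ideal.mem_span_singleton_self _)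
      · rw [show s i = X i from if_neg hi]
    rw [← Ideal.Quotient.eq_zero_iff_mem]
    change q f = 0
    rw [← hq, AlgHom.comp_apply, h, map_zero]
  · refine MvPolynomial.funext fun x => ?_
    rw [map_zero, ← hf (fun i => eval x (s i)) (by rw [← map_sum, hs, map_zero])]
    rw [← coe_aeval_eq_eval, ← coe_aeval_eq_eval]
    change ((aeval x).comp (aeval s)) f = aeval _ f
    congr 1
    ext i
    simp

theorem linForm_dvd {A : Finset ι} (hA : A.Nonempty) {f : MvPolynomial ι ℂ}
    (hf : ∀ x : ι → ℂ, ∑ i ∈ A, x i = 0 → eval x f = 0) : linForm A ∣ f := by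
  obtain ⟨φ, h1, h2⟩ := exists_algHom_linForm_dvd_iff hA
  exact (h1 f).2 (h2 f hf)

theorem linForm_ne_zero {A : Finset ι} (hA : A.Nonempty) : linForm A ≠ 0 := by
  classical
  obtain ⟨a, ha⟩ := hA
  intro h
  have := congrArg (eval (Pi.single a (1 : ℂ))) h
  rw [eval_linForm, map_zero, Finset.sum_pi_single', if_pos ha] at this
  exact one_ne_zero this

theorem linForm_prime {A : Finset ι} (hA : A.Nonempty) : Prime (linForm A) := by
  obtain ⟨φ, h1, -⟩ := exists_algHom_linForm_dvd_iff hA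
  refine ⟨linForm_ne_zero hA, fun h => ?_, fun f g h => ?_⟩
  · have := (h1 1).1 h.dvd
    rw [map_one] at this
    exact one_ne_zero this
  · rw [h1, map_mul, mul_eq_zero] at h
    rwa [h1, h1]

theorem subset_of_linForm_dvd {A B : Finset ι} (h : linForm A ∣ linForm B) : B ⊆ A := by
  classical
  intro i hi
  by_contra hiA
  obtain ⟨g, hg⟩ := h
  have := congrArg (eval (Pi.single i (1 : ℂ))) hg
  rw [map_mul, eval_linForm, eval_linForm, Finset.sum_pi_single', Finset.sum_pi_single',
    if_pos hi, if_neg hiA, zero_mul] at this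
  exact one_ne_zero this

theorem prod_linForm_dvd {s : Finset (Finset ι)} (hs : ∀ A ∈ s, A.Nonempty)
    {f : MvPolynomial ι ℂ} (hf : ∀ A ∈ s, linForm A ∣ f) : ∏ A ∈ s, linForm A ∣ f := by
  classical
  refine Multiset.prod_primes_dvd f ?_ ?_ fun a => ?_
  · intro a ha
    obtain ⟨A, hA, rfl⟩ := Multiset.mem_map.1 ha
    exact linForm_prime (hs A hA)
  · intro a ha
    obtain ⟨A, hA, rfl⟩ := Multiset.mem_map.1 ha
    exact hf A hA
  · rw [Multiset.countP_map, ← Finset.filter_val, Finset.card_val, Finset.card_le_one]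
    intro A hA B hB
    have h := ((Finset.mem_filter.1 hA).2.symm.trans (Finset.mem_filter.1 hB).2)
    exact (subset_of_linForm_dvd h.symm.dvd).antisymm (subset_of_linForm_dvd h.dvd)

end LinearForm

section Invariants

variable {D : Derivation ℂ (MvPolynomial ℕ ℂ) (MvPolynomial ℕ ℂ)}

theorem apply_tupleMonomial (hD0 : D (X 0) = 0) (hD : ∀ i : ℕ, D (X (i + 1)) = X i) {n : ℕ}
    (r : Fin n →₀ ℕ) : D (tupleMonomial r) =
      ∑ i, if i ∈ r.support then tupleMonomial (r - Finsupp.single i 1) else 0 := by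
  classical
  rw [tupleMonomial, D.leibniz_finset_prod]
  refine Finset.sum_congr rfl fun i _ => ?_
  split_ifs with h
  · obtain ⟨k, hk⟩ := Nat.exists_eq_succ_of_ne_zero (Finsupp.mem_support_iff.1 h)
    rw [tupleMonomial, ← Finset.prod_erase_mul _ _ (Finset.mem_univ i), hk, hD, smul_eq_mul]
    congr 1
    · refine Finset.prod_congr rfl fun j hj => ?_
      rw [Finsupp.tsub_apply, Finsupp.single_eq_of_ne (Finset.ne_of_mem_erase hj), tsub_zero]
    · simp [hk]
  · rw [Finsupp.notMem_support_iff.1 h, hD0, smul_zero]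

theorem coeff_linForm_univ_mul (hD0 : D (X 0) = 0) (hD : ∀ i : ℕ, D (X (i + 1)) = X i) {n : ℕ}
    (φ : MvPolynomial ℕ ℂ →ₗ[ℂ] ℂ) (H : MvPolynomial (Fin n) ℂ) (r : Fin n →₀ ℕ)
    (hH : ∀ i ∈ r.support, coeff (r - Finsupp.single i 1) H =
      φ (tupleMonomial (r - Finsupp.single i 1))) :
    coeff r (linForm Finset.univ * H) = φ (D (tupleMonomial r)) := by
  classical
  rw [apply_tupleMonomial hD0 hD, linForm, Finset.sum_mul, coeff_sum, map_sum]
  refine Finset.sum_congr rfl fun i _ => ?_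
  rw [coeff_X_mul']
  split_ifs with h
  · exact hH i h
  · rw [map_zero]

theorem dualPoly_comp_zero (hD0 : D (X 0) = 0) (φ : MvPolynomial ℕ ℂ →ₗ[ℂ] ℂ) (n : ℕ) :
    dualPoly (φ ∘ₗ (D : MvPolynomial ℕ ℂ →ₗ[ℂ] MvPolynomial ℕ ℂ)) n 0 = 0 := by
  ext r
  rw [coeff_dualPoly, coeff_zero]
  split_ifs with h
  · have hr : r = 0 := by
      ext i
      exact (Finset.sum_eq_zero_iff.1 h) i (Finset.mem_univ i)
    subst hr
    classical
    simp [tupleMonomial, hD0]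
  · rfl

theorem dualPoly_comp_succ (hD0 : D (X 0) = 0) (hD : ∀ i : ℕ, D (X (i + 1)) = X i)
    (φ : MvPolynomial ℕ ℂ →ₗ[ℂ] ℂ) (n g : ℕ) :
    dualPoly (φ ∘ₗ (D : MvPolynomial ℕ ℂ →ₗ[ℂ] MvPolynomial ℕ ℂ)) n (g + 1) =
      linForm Finset.univ * dualPoly φ n g := by
  ext r
  rw [coeff_dualPoly]
  split_ifs with h
  · rw [coeff_linForm_univ_mul hD0 hD φ _ r]
    · rfl
    · intro i hi
      rw [coeff_dualPoly, if_pos]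
      have h1 : Finsupp.single i 1 ≤ r := by
        rw [Finsupp.single_le_iff]
        exact Nat.one_le_iff_ne_zero.2 (Finsupp.mem_support_iff.1 hi)
      have h2 : (r - Finsupp.single i 1 + Finsupp.single i 1).degree = g + 1 := by
        rw [tsub_add_cancel_of_le h1, Finsupp.degree_eq_sum, h]
      rw [map_add, Finsupp.degree_single] at h2
      rw [← Finsupp.degree_eq_sum]
      omega
  · have h1 : (linForm Finset.univ * dualPoly φ n g).IsHomogeneous (1 + g) :=
      (IsHomogeneous.sum _ _ _ fun i _ => isHomogeneous_X _ _).mul (dualPoly_isHomogeneous φ n g)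
    refine (h1.coeff_eq_zero ?_).symm
    rw [Finsupp.degree_eq_sum]
    omega

theorem potAt_mem_Sng (hD0 : D (X 0) = 0) (hD : ∀ i : ℕ, D (X (i + 1)) = X i) {n : ℕ}
    (x : Fin n → ℂ) (hx : ∑ i, x i = 0) (g : ℕ) : potAt x g ∈ Sng D n g := by
  refine ⟨?_, potAt_mem_Rng x g⟩
  change D (potAt x g) = 0
  refine (Module.forall_dual_apply_eq_zero_iff ℂ _).1 fun φ => ?_
  change (φ ∘ₗ (D : MvPolynomial ℕ ℂ →ₗ[ℂ] MvPolynomial ℕ ℂ)) (potAt x g) = 0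
  rw [← eval_dualPoly]
  cases g with
  | zero => rw [dualPoly_comp_zero hD0, map_zero]
  | succ g => rw [dualPoly_comp_succ hD0 hD, map_mul, eval_linForm, hx, zero_mul]

theorem linForm_univ_isSymmetric (n : ℕ) :
    (linForm (Finset.univ : Finset (Fin n))).IsSymmetric := by
  intro σ
  rw [linForm, map_sum]
  simp only [rename_X]
  exact Equiv.sum_comp σ (fun i => (X i : MvPolynomial (Fin n) ℂ))

theorem Sng_le_span_potAt (hD0 : D (X 0) = 0) (hD : ∀ i : ℕ, D (X (i + 1)) = X i) {n : ℕ}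
    (hn : 0 < n) (g : ℕ) :
    Sng D n g ≤ Submodule.span ℂ {p | ∃ x : Fin n → ℂ, ∑ i, x i = 0 ∧ p = potAt x g} := by
  intro s hs
  by_contra hsp
  obtain ⟨ψ, hψs, hψ⟩ := Submodule.exists_le_ker_of_notMem hsp
  have hne : (Finset.univ : Finset (Fin n)).Nonempty := ⟨⟨0, hn⟩, Finset.mem_univ _⟩
  obtain ⟨H, hH⟩ : linForm Finset.univ ∣ dualPoly ψ n g := linForm_dvd hne fun x hx => by
    rw [eval_dualPoly]
    exact hψ (Submodule.subset_span ⟨x, hx, rfl⟩)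
  have hHs : H.IsSymmetric := fun σ => by
    have h := dualPoly_isSymmetric ψ n g σ
    rw [hH, map_mul, linForm_univ_isSymmetric n σ] at h
    exact mul_left_cancel₀ (linForm_ne_zero hne) h
  have key : Rng n g ≤ LinearMap.ker (ψ - coeffFunctional H ∘ₗ
      (D : MvPolynomial ℕ ℂ →ₗ[ℂ] MvPolynomial ℕ ℂ)) := by
    refine (Rng_le_span n g).trans (Submodule.span_le.2 ?_)
    rintro _ ⟨r, hr, rfl⟩
    have h1 := coeff_dualPoly ψ g r
    rw [if_pos hr, hH, coeff_linForm_univ_mul hD0 hD (coeffFunctional H) H r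
      fun i _ => (coeffFunctional_tupleMonomial hHs _).symm] at h1
    simp [h1]
  have h2 := key hs.2
  have h3 : D s = 0 := hs.1
  rw [LinearMap.mem_ker, LinearMap.sub_apply, LinearMap.comp_apply, Derivation.coeFn_coe, h3,
    map_zero, sub_zero] at h2
  exact hψs h2

/-- A polynomial vanishes on the arrangement of the subspaces
`∑_{i ∈ A} λᵢ = ∑_{i ∉ A} λᵢ = 0` for `A` a nonempty proper subset of the indices. -/
def VanishesOnArrangement {n : ℕ} (F : MvPolynomial (Fin n) ℂ) : Prop :=
  ∀ (x : Fin n → ℂ) (A : Finset (Fin n)), A.Nonempty → Aᶜ.Nonempty →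
    ∑ i ∈ A, x i = 0 → ∑ i ∈ Aᶜ, x i = 0 → eval x F = 0

theorem mul_mem_Dec {n g a b j k : ℕ} (ha : 0 < a) (hb : 0 < b) (hab : a + b = n) (hjk : j + k = g)
    {p q : MvPolynomial ℕ ℂ} (hp : p ∈ Sng D a j) (hq : q ∈ Sng D b k) : p * q ∈ Dec D n g := by
  have h1 : Sng D a j * Sng D (n - a) (g - j) ≤ Dec D n g :=
    le_iSup₂_of_le (f := fun h (_ : h ∈ Finset.Icc 1 (n - 1)) =>
      ⨆ j ∈ Finset.range (g + 1), Sng D h j * Sng D (n - h) (g - j)) a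
      (Finset.mem_Icc.2 (by omega))
      (le_iSup₂_of_le (f := fun j (_ : j ∈ Finset.range (g + 1)) =>
        Sng D a j * Sng D (n - a) (g - j)) j (Finset.mem_range.2 (by omega)) le_rfl)
  rw [show n - a = b by omega, show g - j = k by omega] at h1
  exact h1 (Submodule.mul_mem_mul hp hq)

theorem Dec_le_Sng (n g : ℕ) : Dec D n g ≤ Sng D n g := by
  refine iSup₂_le fun h hh => iSup₂_le fun j hj => Submodule.mul_le.2 fun p hp q hq => ⟨?_, ?_⟩
  · have h1 : D p = 0 := hp.1
    have h2 : D q = 0 := hq.1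
    change D (p * q) = 0
    rw [D.leibniz, h1, h2, smul_zero, smul_zero, add_zero]
  · have h1 : Rng h j * Rng (n - h) (g - j) ≤ Rng n g := by
      rw [Rng, Rng, Submodule.span_mul_span]
      refine Submodule.span_mono ?_
      rintro _ ⟨_, ⟨m, hm, hm', rfl⟩, _, ⟨m', hn, hn', rfl⟩, rfl⟩
      rw [Finset.mem_Icc] at hh
      rw [Finset.mem_range] at hj
      refine ⟨m + m', ?_, ?_, ?_⟩
      · rw [Finsupp.sum_add_index' (by simp) (by simp), hm, hn]
        omega
      · rw [Finsupp.sum_add_index' (by simp) (by intros; ring), hm', hn']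
        omega
      · simp [monomial_mul]
    exact h1 (Submodule.mul_mem_mul hp.2 hq.2)

theorem dualPoly_vanishesOnArrangement (hD0 : D (X 0) = 0) (hD : ∀ i : ℕ, D (X (i + 1)) = X i)
    {n g : ℕ} {ψ : MvPolynomial ℕ ℂ →ₗ[ℂ] ℂ} (hψ : Dec D n g ≤ LinearMap.ker ψ) :
    VanishesOnArrangement (dualPoly ψ n g) := by
  intro x A hA hA' h1 h2
  have hsum (B : Finset (Fin n)) : ∑ i, x (B.equivFin.symm i) = ∑ i ∈ B, x i := by
    rw [Equiv.sum_comp B.equivFin.symm (fun i => x i), Finset.sum_coe_sort B x]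
  rw [eval_dualPoly, potAt_eq_sum_compl x A]
  refine hψ (Submodule.sum_mem _ fun p hp => ?_)
  refine mul_mem_Dec hA.card_pos hA'.card_pos ?_ (Finset.HasAntidiagonal.mem_antidiagonal.1 hp)
    (potAt_mem_Sng hD0 hD _ (by rw [hsum, h1]) _) (potAt_mem_Sng hD0 hD _ (by rw [hsum, h2]) _)
  rw [Finset.card_add_card_compl, Fintype.card_fin]

theorem Dec_le_ker (hD0 : D (X 0) = 0) (hD : ∀ i : ℕ, D (X (i + 1)) = X i)
    {n g : ℕ} {ψ : MvPolynomial ℕ ℂ →ₗ[ℂ] ℂ} (hψ : VanishesOnArrangement (dualPoly ψ n g)) :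
    Dec D n g ≤ LinearMap.ker ψ := by
  refine iSup₂_le fun a ha => iSup₂_le fun j hj => ?_
  rw [Finset.mem_Icc] at ha
  rw [Finset.mem_range] at hj
  obtain ⟨b, rfl⟩ : ∃ b, n = a + b := ⟨n - a, by omega⟩
  obtain ⟨k, rfl⟩ : ∃ k, g = j + k := ⟨g - j, by omega⟩
  rw [show a + b - a = b by omega, show j + k - j = k by omega]
  refine (mul_le_mul' (Sng_le_span_potAt hD0 hD (by omega) j)
    (Sng_le_span_potAt hD0 hD (by omega) k)).trans ?_
  rw [Submodule.span_mul_span]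
  refine Submodule.span_le.2 ?_
  rintro _ ⟨_, ⟨x, hx, rfl⟩, _, ⟨y, hy, rfl⟩, rfl⟩
  let p : Polynomial ℂ := ∑ q ∈ Finset.HasAntidiagonal.antidiagonal (j + k),
    Polynomial.monomial q.1 (ψ (potAt x q.1 * potAt y q.2))
  have hp : p = 0 := by
    refine Polynomial.funext fun t => ?_
    let A : Finset (Fin (a + b)) := Finset.univ.map (Fin.castAddEmb b)
    have hA : ∑ i ∈ A, Fin.append (t • x) y i = 0 := by
      simp [A, Finset.sum_map, ← Finset.mul_sum, hx]
    have hA' : ∑ i ∈ Aᶜ, Fin.append (t • x) y i = 0 := by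
      have h := Finset.sum_add_sum_compl A (Fin.append (t • x) y)
      rw [hA, zero_add, Fin.sum_univ_add] at h
      rw [h]
      simp [← Finset.mul_sum, hx, hy]
    have hc : A.card + Aᶜ.card = a + b := by
      rw [Finset.card_add_card_compl, Fintype.card_fin]
    have hcA : A.card = a := by simp [A]
    have h := hψ (Fin.append (t • x) y) A (Finset.card_pos.1 (by omega))
      (Finset.card_pos.1 (by omega)) hA hA'
    rw [eval_dualPoly, potAt_append, map_sum] at h
    rw [Polynomial.eval_zero, ← h, Polynomial.eval_finsetSum]
    refine Finset.sum_congr rfl fun q _ => ?_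
    rw [Polynomial.eval_monomial, potAt_smul, smul_mul_assoc, map_smul, smul_eq_mul, mul_comm]
  have h := congrArg (fun q => Polynomial.coeff q j) hp
  simp only [p, Polynomial.finsetSum_coeff, Polynomial.coeff_monomial, Polynomial.coeff_zero] at h
  rw [Finset.sum_eq_single (j, k)] at h
  · simpa using h
  · intro q hq hne
    rw [Finset.HasAntidiagonal.mem_antidiagonal] at hq
    refine if_neg fun hqj => hne (Prod.ext hqj ?_)
    change q.2 = k
    omega
  · intro hq
    exact absurd (by rw [Finset.HasAntidiagonal.mem_antidiagonal]) hq

end Invariants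

section Restriction

/-- The restriction of polynomials to the hyperplane `∑ λᵢ = 0`, which is parametrized by all
coordinates but the zeroth. -/
def hyperplaneRestrict (m : ℕ) : MvPolynomial (Fin (m + 2)) ℂ →ₐ[ℂ] MvPolynomial (Fin (m + 1)) ℂ :=
  aeval (Fin.cons (-linForm Finset.univ) X)

/-- Evaluation of a polynomial at the elementary symmetric polynomials. -/
def evalEsymm (n : ℕ) : MvPolynomial (Fin n) ℂ →ₐ[ℂ] MvPolynomial (Fin n) ℂ :=
  aeval fun i => esymm (Fin n) ℂ (i + 1)

variable {m : ℕ}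

theorem hyperplaneRestrict_esymm (j : ℕ) :
    hyperplaneRestrict m (esymm (Fin (m + 2)) ℂ (j + 1)) =
      esymm (Fin (m + 1)) ℂ (j + 1) - linForm Finset.univ * esymm (Fin (m + 1)) ℂ j := by
  have hu : (Finset.univ : Finset (Fin (m + 2))).val = 0 ::ₘ Finset.univ.val.map Fin.succ := by
    rw [Fin.univ_succ]
    rfl
  rw [hyperplaneRestrict, aeval_esymm_eq_multiset_esymm, hu, Multiset.map_cons, Fin.cons_zero,
    Multiset.map_map, esymm_eq_multiset_esymm]
  have h : (Fin.cons (-linForm Finset.univ) X : Fin (m + 2) → MvPolynomial (Fin (m + 1)) ℂ) ∘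
      Fin.succ = X :=
    funext fun i => Fin.cons_succ _ _ i
  rw [h]
  simp only [Multiset.esymm, Multiset.powersetCard_cons, Multiset.map_add, Multiset.map_map,
    Multiset.sum_add, Function.comp_def, Multiset.prod_cons, Multiset.sum_map_mul_left]
  ring

theorem hyperplaneRestrict_esymm_one : hyperplaneRestrict m (esymm (Fin (m + 2)) ℂ 1) = 0 := by
  rw [hyperplaneRestrict_esymm 0, esymm_zero, esymm_one, linForm, mul_one, sub_self]

theorem evalEsymm_monomial {n : ℕ} (k : Fin n →₀ ℕ) (c : ℂ) :
    evalEsymm n (monomial k c) = c • ∏ i : Fin n, esymm (Fin n) ℂ (i + 1) ^ k i := by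
  rw [evalEsymm, aeval_monomial, Finsupp.prod_fintype _ _ fun i => pow_zero _, algebraMap_eq,
    smul_eq_C_mul]

theorem evalEsymm_isSymmetric {n : ℕ} (p : MvPolynomial (Fin n) ℂ) :
    (evalEsymm n p).IsSymmetric := by
  rw [evalEsymm, ← esymmAlgHom_apply]
  exact (esymmAlgHom (Fin n) ℂ n p).2

theorem exists_evalEsymm_eq {n : ℕ} {F : MvPolynomial (Fin n) ℂ} (hF : F.IsSymmetric) :
    ∃ p, evalEsymm n p = F := by
  obtain ⟨p, hp⟩ := esymmAlgHom_fin_surjective ℂ le_rfl (⟨F, hF⟩ : symmetricSubalgebra (Fin n) ℂ)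
  exact ⟨p, by rw [evalEsymm, ← esymmAlgHom_apply, hp]⟩

theorem evalEsymm_injective (n : ℕ) : Function.Injective (evalEsymm n) := fun p q h => by
  rw [evalEsymm, ← esymmAlgHom_apply, ← esymmAlgHom_apply] at h
  exact esymmAlgHom_fin_injective ℂ le_rfl (Subtype.ext h)

/-- The lexicographic degree of the restriction to `∑ λᵢ = 0` of a monomial in the elementary
symmetric polynomials of positive index. -/
def hyperplaneDegree (m : ℕ) : (Fin (m + 2) →₀ ℕ) →+ (Fin (m + 1) →₀ ℕ) where
  toFun k := Finsupp.equivFunOnFinite.symm fun j =>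
    (if j = 0 then 2 else 1) * Fin.accumulate (m + 1) (m + 1) (fun i => k i.succ) j
  map_zero' := by
    ext j
    simp
  map_add' k l := by
    ext j
    simp [Finset.sum_add_distrib, mul_add]

theorem hyperplaneDegree_apply (k : Fin (m + 2) →₀ ℕ) (j : Fin (m + 1)) :
    hyperplaneDegree m k j =
      (if j = 0 then 2 else 1) * Fin.accumulate (m + 1) (m + 1) (fun i => k i.succ) j := rfl

theorem eq_of_hyperplaneDegree_eq {k l : Fin (m + 2) →₀ ℕ} (hk : k 0 = l 0)
    (h : hyperplaneDegree m k = hyperplaneDegree m l) : k = l := by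
  have h1 : (fun i : Fin (m + 1) => k i.succ) = fun i => l i.succ := by
    refine Fin.accumulate_injective le_rfl (funext fun j => ?_)
    have h2 := DFunLike.congr_fun h j
    rw [hyperplaneDegree_apply, hyperplaneDegree_apply] at h2
    refine Nat.eq_of_mul_eq_mul_left ?_ h2
    split_ifs <;> norm_num
  ext i
  refine Fin.cases hk (fun i => ?_) i
  exact congrFun h1 i

theorem lex_degree_esymm (i : Fin m) (j : Fin m) :
    MonomialOrder.lex.degree (esymm (Fin m) ℂ (i + 1)) j = if j ≤ i then 1 else 0 := by
  have h := congrFun (supDegree_esymm (R := ℂ) (n := m) i.2) j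
  refine Eq.trans h ?_
  simp [Finsupp.single_apply]

theorem lex_lt_of_apply_zero_lt {k l : Fin (m + 1) →₀ ℕ} (h : k 0 < l 0) :
    MonomialOrder.lex.toSyn k < MonomialOrder.lex.toSyn l := by
  rw [MonomialOrder.lex_lt_iff, Finsupp.Lex.lt_iff]
  exact ⟨0, fun j hj => absurd hj (Fin.not_lt_zero j), h⟩

theorem lex_degree_hyperplaneRestrict_esymm (i : Fin (m + 1)) :
    hyperplaneRestrict m (esymm (Fin (m + 2)) ℂ (i + 2)) ≠ 0 ∧
    MonomialOrder.lex.degree (hyperplaneRestrict m (esymm (Fin (m + 2)) ℂ (i + 2))) =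
      hyperplaneDegree m (Finsupp.single i.succ 1) := by
  have hl : linForm (Finset.univ : Finset (Fin (m + 1))) =
      esymm (Fin (m + 1)) ℂ ((0 : Fin (m + 1)) + 1) := by
    rw [Fin.val_zero, zero_add, esymm_one, linForm]
  have hl0 : linForm (Finset.univ : Finset (Fin (m + 1))) ≠ 0 :=
    linForm_ne_zero Finset.univ_nonempty
  have he0 : esymm (Fin (m + 1)) ℂ (i + 1) ≠ 0 := fun h => by
    have := lex_degree_esymm i 0
    rw [h] at this
    simp at this
  have hmul : MonomialOrder.lex.degree (linForm Finset.univ * esymm (Fin (m + 1)) ℂ (i + 1)) =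
      hyperplaneDegree m (Finsupp.single i.succ 1) := by
    rw [MonomialOrder.degree_mul hl0 he0, hl]
    ext j
    rw [Finsupp.add_apply, lex_degree_esymm, lex_degree_esymm, hyperplaneDegree_apply]
    by_cases hj : j = 0
    · subst hj
      simp [Finsupp.single_apply]
    · simp [Finsupp.single_apply, hj]
  have hlt : MonomialOrder.lex.toSyn (MonomialOrder.lex.degree (esymm (Fin (m + 1)) ℂ (i + 1 + 1))) <
      MonomialOrder.lex.toSyn
        (MonomialOrder.lex.degree (linForm Finset.univ * esymm (Fin (m + 1)) ℂ (i + 1))) := by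
    refine lex_lt_of_apply_zero_lt ?_
    have h2 : hyperplaneDegree m (Finsupp.single i.succ 1) 0 = 2 := by
      simp [hyperplaneDegree_apply, Finsupp.single_apply]
    rw [hmul, h2]
    by_cases h : (i : ℕ) + 1 < m + 1
    · have := lex_degree_esymm (⟨i + 1, h⟩ : Fin (m + 1)) 0
      rw [this]
      simp
    · rw [esymm, Finset.powersetCard_eq_empty.2 (by simp; omega)]
      simp
  have hi : hyperplaneRestrict m (esymm (Fin (m + 2)) ℂ (i + 2)) = _ :=
    hyperplaneRestrict_esymm ((i : ℕ) + 1)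
  have hdeg : MonomialOrder.lex.degree (hyperplaneRestrict m (esymm (Fin (m + 2)) ℂ (i + 2))) =
      hyperplaneDegree m (Finsupp.single i.succ 1) := by
    rw [hi, ← neg_sub, MonomialOrder.degree_neg, MonomialOrder.degree_sub_of_lt hlt, hmul]
  refine ⟨fun h => ?_, hdeg⟩
  rw [h, MonomialOrder.degree_zero] at hdeg
  have := DFunLike.congr_fun hdeg 0
  simp [hyperplaneDegree_apply, Finsupp.single_apply] at this

theorem hyperplaneRestrict_evalEsymm_monomial_eq_zero {k : Fin (m + 2) →₀ ℕ} (hk : k 0 ≠ 0)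
    (c : ℂ) :
    hyperplaneRestrict m (evalEsymm (m + 2) (monomial k c)) = 0 := by
  rw [evalEsymm_monomial, map_smul, map_prod,
    Finset.prod_eq_zero (Finset.mem_univ 0), smul_zero]
  rw [Fin.val_zero, zero_add, map_pow, hyperplaneRestrict_esymm_one, zero_pow hk]

theorem lex_degree_hyperplaneRestrict_evalEsymm_monomial {k : Fin (m + 2) →₀ ℕ} (hk : k 0 = 0) :
    hyperplaneRestrict m (evalEsymm (m + 2) (monomial k 1)) ≠ 0 ∧
    MonomialOrder.lex.degree (hyperplaneRestrict m (evalEsymm (m + 2) (monomial k 1))) =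
      hyperplaneDegree m k := by
  have h (i : Fin (m + 1)) : hyperplaneRestrict m (esymm (Fin (m + 2)) ℂ (i.succ + 1)) =
      hyperplaneRestrict m (esymm (Fin (m + 2)) ℂ (i + 2)) := by
    rw [Fin.val_succ]
  rw [evalEsymm_monomial, one_smul, map_prod, Fin.prod_univ_succ, hk, pow_zero, map_one, one_mul]
  simp only [map_pow, h]
  have h0 (i : Fin (m + 1)) :
      hyperplaneRestrict m (esymm (Fin (m + 2)) ℂ (i + 2)) ^ k i.succ ≠ 0 :=
    pow_ne_zero _ (lex_degree_hyperplaneRestrict_esymm i).1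
  refine ⟨Finset.prod_ne_zero_iff.2 fun i _ => h0 i, ?_⟩
  rw [MonomialOrder.degree_prod fun i _ => h0 i]
  simp only [MonomialOrder.degree_pow, (lex_degree_hyperplaneRestrict_esymm _).2]
  simp only [← map_nsmul, ← map_sum]
  congr 1
  ext j
  rw [Finsupp.finsetSum_apply]
  refine Fin.cases ?_ (fun j => ?_) j
  · simp [hk]
  · simp [Finsupp.single_apply]

theorem hyperplaneRestrict_evalEsymm_eq_sum (p : MvPolynomial (Fin (m + 2)) ℂ) :
    hyperplaneRestrict m (evalEsymm (m + 2) p) = ∑ k ∈ p.support with k 0 = 0,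
      coeff k p • hyperplaneRestrict m (evalEsymm (m + 2) (monomial k 1)) := by
  conv_lhs => rw [p.as_sum]
  rw [map_sum, map_sum, Finset.sum_filter]
  refine Finset.sum_congr rfl fun k _ => ?_
  split_ifs with h
  · rw [← map_smul, ← map_smul, smul_monomial, smul_eq_mul, mul_one]
  · exact hyperplaneRestrict_evalEsymm_monomial_eq_zero h _

theorem lex_degree_hyperplaneRestrict_evalEsymm {p : MvPolynomial (Fin (m + 2)) ℂ}
    (hp : ∃ k ∈ p.support, k 0 = 0) :
    hyperplaneRestrict m (evalEsymm (m + 2) p) ≠ 0 ∧ ∃ k ∈ p.support, k 0 = 0 ∧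
      MonomialOrder.lex.degree (hyperplaneRestrict m (evalEsymm (m + 2) p)) = hyperplaneDegree m k ∧
      ∀ l ∈ p.support, l 0 = 0 → MonomialOrder.lex.toSyn (hyperplaneDegree m l) ≤
        MonomialOrder.lex.toSyn (hyperplaneDegree m k) := by
  obtain ⟨k₁, hk₁⟩ := hp
  obtain ⟨k, hk, hmax⟩ := (p.support.filter fun k => k 0 = 0).exists_max_image
    (fun k => MonomialOrder.lex.toSyn (hyperplaneDegree m k)) ⟨k₁, Finset.mem_filter.2 hk₁⟩
  have hk' := Finset.mem_filter.1 hk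
  have hcoeff : coeff (hyperplaneDegree m k) (hyperplaneRestrict m (evalEsymm (m + 2) p)) ≠ 0 := by
    rw [hyperplaneRestrict_evalEsymm_eq_sum, coeff_sum, Finset.sum_eq_single k]
    · rw [coeff_smul, smul_eq_mul]
      have h := lex_degree_hyperplaneRestrict_evalEsymm_monomial hk'.2
      refine mul_ne_zero (mem_support_iff.1 hk'.1) ?_
      rw [← h.2]
      exact MonomialOrder.coeff_degree_ne_zero_iff.2 h.1
    · intro l hl hlk
      have hl' := Finset.mem_filter.1 hl
      have hlt : MonomialOrder.lex.toSyn
        (MonomialOrder.lex.degree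
          (hyperplaneRestrict m (evalEsymm (m + 2) (monomial l 1)))) <
            MonomialOrder.lex.toSyn (hyperplaneDegree m k) := by
        rw [(lex_degree_hyperplaneRestrict_evalEsymm_monomial hl'.2).2]
        refine lt_of_le_of_ne (hmax l hl) fun h => hlk ?_
        exact eq_of_hyperplaneDegree_eq (hl'.2.trans hk'.2.symm)
          (MonomialOrder.lex.toSyn.injective h)
      rw [coeff_smul, MonomialOrder.coeff_eq_zero_of_lt hlt]
      exact smul_zero (coeff l p)
    · exact fun h => absurd hk h
  refine ⟨fun h => hcoeff (by rw [h, coeff_zero]), k, hk'.1, hk'.2, ?_,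
    fun l hl hl0 => hmax l (Finset.mem_filter.2 ⟨hl, hl0⟩)⟩
  refine MonomialOrder.lex.toSyn.injective (le_antisymm ?_
    (MonomialOrder.le_degree (mem_support_iff.2 hcoeff)))
  rw [hyperplaneRestrict_evalEsymm_eq_sum]
  refine MonomialOrder.degree_sum_le.trans (Finset.sup_le fun l hl => ?_)
  refine MonomialOrder.degree_smul_le.trans ?_
  rw [(lex_degree_hyperplaneRestrict_evalEsymm_monomial (Finset.mem_filter.1 hl).2).2]
  exact hmax l hl

end Restriction

section Symmetrization

variable {n : ℕ}

/-- The average of a polynomial over all permutations of the variables. -/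
def symmetrize (G : MvPolynomial (Fin n) ℂ) : MvPolynomial (Fin n) ℂ :=
  (n.factorial : ℂ)⁻¹ • ∑ σ : Equiv.Perm (Fin n), rename σ G

theorem symmetrize_isSymmetric (G : MvPolynomial (Fin n) ℂ) : (symmetrize G).IsSymmetric := by
  intro τ
  rw [symmetrize, map_smul, map_sum]
  congr 1
  simp only [rename_rename, ← Equiv.Perm.coe_mul]
  exact Fintype.sum_equiv (Equiv.mulLeft τ) _ _ fun σ => rfl

theorem symmetrize_isHomogeneous {G : MvPolynomial (Fin n) ℂ} {d : ℕ} (hG : G.IsHomogeneous d) :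
    (symmetrize G).IsHomogeneous d := by
  rw [symmetrize, smul_eq_C_mul]
  exact (IsHomogeneous.sum _ _ _ fun σ _ => hG.rename_isHomogeneous).C_mul _

theorem map_symmetrize {S : Type*} [CommRing S] [Algebra ℂ S] (f : MvPolynomial (Fin n) ℂ →ₐ[ℂ] S)
    {G : MvPolynomial (Fin n) ℂ} {H : S} (h : ∀ σ : Equiv.Perm (Fin n), f (rename σ G) = H) :
    f (symmetrize G) = H := by
  rw [symmetrize, map_smul, map_sum, Finset.sum_congr rfl fun σ _ => h σ, Finset.sum_const,
    Finset.card_univ, Fintype.card_perm, Fintype.card_fin, ← Nat.cast_smul_eq_nsmul ℂ, smul_smul,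
    inv_mul_cancel₀ (Nat.cast_ne_zero.2 n.factorial_ne_zero), one_smul]

end Symmetrization

section Arrangement

variable {m : ℕ}

theorem hyperplaneRestrict_X_zero : hyperplaneRestrict m (X 0) = -linForm Finset.univ := by
  rw [hyperplaneRestrict, aeval_X, Fin.cons_zero]

theorem hyperplaneRestrict_X_succ (i : Fin (m + 1)) : hyperplaneRestrict m (X i.succ) = X i := by
  rw [hyperplaneRestrict, aeval_X, Fin.cons_succ]

theorem hyperplaneRestrict_rename_succ (G : MvPolynomial (Fin (m + 1)) ℂ) :
    hyperplaneRestrict m (rename Fin.succ G) = G := by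
  have h : (hyperplaneRestrict m).comp (rename Fin.succ) = AlgHom.id ℂ _ := by
    ext1 i
    simp [hyperplaneRestrict_X_succ]
  exact DFunLike.congr_fun h G

theorem hyperplaneRestrict_linForm_univ : hyperplaneRestrict m (linForm Finset.univ) = 0 := by
  rw [linForm, Fin.sum_univ_succ, map_add, hyperplaneRestrict_X_zero, map_sum]
  simp only [hyperplaneRestrict_X_succ]
  rw [linForm, neg_add_cancel]

theorem hyperplaneRestrict_linForm_compl (B : Finset (Fin (m + 2))) :
    hyperplaneRestrict m (linForm Bᶜ) = -hyperplaneRestrict m (linForm B) := by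
  rw [eq_neg_iff_add_eq_zero, ← map_add, linForm, linForm, Finset.sum_compl_add_sum]
  exact hyperplaneRestrict_linForm_univ

theorem hyperplaneRestrict_rename_lift (σ : Equiv.Perm (Fin (m + 2)))
    (F : MvPolynomial (Fin (m + 2)) ℂ) :
    hyperplaneRestrict m (rename σ (rename Fin.succ (hyperplaneRestrict m F))) =
      hyperplaneRestrict m (rename σ F) := by
  have h : ((hyperplaneRestrict m).comp (rename σ)).comp
      ((rename Fin.succ).comp (hyperplaneRestrict m)) = (hyperplaneRestrict m).comp (rename σ) := by
    ext1 i
    refine Fin.cases ?_ (fun i => ?_) i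
    · have h0 : hyperplaneRestrict m (rename σ (linForm Finset.univ)) = 0 := by
        rw [linForm_univ_isSymmetric, hyperplaneRestrict_linForm_univ]
      rw [linForm, Fin.sum_univ_succ, map_add, map_add] at h0
      simp only [AlgHom.comp_apply, hyperplaneRestrict_X_zero, map_neg]
      rw [eq_neg_of_add_eq_zero_left h0, linForm, map_sum]
      simp only [rename_X]
    · simp [hyperplaneRestrict_X_succ]
  exact DFunLike.congr_fun h F

theorem eval_hyperplaneRestrict (x : Fin (m + 2) → ℂ) (hx : ∑ i, x i = 0)
    (F : MvPolynomial (Fin (m + 2)) ℂ) :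
    eval (Fin.tail x) (hyperplaneRestrict m F) = eval x F := by
  have h : (aeval (Fin.tail x)).comp (hyperplaneRestrict m) = aeval (R := ℂ) x := by
    ext1 i
    refine Fin.cases ?_ (fun i => ?_) i
    · rw [Fin.sum_univ_succ] at hx
      simp only [AlgHom.comp_apply, hyperplaneRestrict_X_zero, map_neg, aeval_eq_eval,
        eval_linForm, eval_X]
      exact (eq_neg_of_add_eq_zero_left hx).symm
    · simp [hyperplaneRestrict_X_succ, Fin.tail]
  exact DFunLike.congr_fun h F

theorem rename_linForm {ι κ : Type*} (f : ι ↪ κ) (A : Finset ι) :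
    rename f (linForm A) = linForm (A.map f) := by
  simp [linForm]

/-- The product of the equations, on the hyperplane `∑ λᵢ = 0`, of the subspaces
`∑_{i ∈ A} λᵢ = ∑_{i ∉ A} λᵢ = 0`. -/
def arrangementPoly (m : ℕ) : MvPolynomial (Fin (m + 1)) ℂ :=
  ∏ A : Finset (Fin (m + 1)) with A.Nonempty, linForm A

theorem arrangementPoly_ne_zero : arrangementPoly m ≠ 0 :=
  Finset.prod_ne_zero_iff.2 fun _ hA => linForm_ne_zero (Finset.mem_filter.1 hA).2

theorem arrangementPoly_isHomogeneous :
    (arrangementPoly m).IsHomogeneous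
      (∑ A : Finset (Fin (m + 1)) with A.Nonempty, 1) :=
  IsHomogeneous.prod _ _ _ fun _ _ => IsHomogeneous.sum _ _ _ fun _ _ => isHomogeneous_X _ _

theorem hyperplaneRestrict_rename_arrangementPoly (σ : Equiv.Perm (Fin (m + 2))) :
    hyperplaneRestrict m (rename σ (rename Fin.succ (arrangementPoly m))) =
      ∏ B : Finset (Fin (m + 2)) with B.Nonempty ∧ σ 0 ∉ B, hyperplaneRestrict m (linForm B) := by
  let f : Fin (m + 1) ↪ Fin (m + 2) := (Fin.succEmb (m + 1)).trans σ.toEmbedding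
  have hf (i) : f i = σ i.succ := rfl
  have hf' : (σ ∘ Fin.succ : Fin (m + 1) → Fin (m + 2)) = f := rfl
  rw [rename_rename, hf', arrangementPoly, map_prod, map_prod]
  refine Finset.prod_bij (fun A _ => A.map f) ?_ ?_ ?_ ?_
  · intro A hA
    simp only [Finset.mem_filter, Finset.mem_univ, true_and] at hA ⊢
    refine ⟨hA.map, ?_⟩
    simp [hf, Fin.succ_ne_zero]
  · intro A _ B _ h
    exact Finset.map_injective f h
  · intro B hB
    simp only [Finset.mem_filter, Finset.mem_univ, true_and] at hB
    have hBf : (Finset.univ.filter fun i => f i ∈ B).map f = B := by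
      ext b
      simp only [Finset.mem_map, Finset.mem_filter, Finset.mem_univ, true_and]
      refine ⟨fun ⟨i, hi, hib⟩ => hib ▸ hi, fun hb => ?_⟩
      obtain ⟨a, rfl⟩ := σ.surjective b
      obtain ⟨i, rfl⟩ := Fin.exists_succ_eq.2 (fun h => hB.2 (by rwa [h] at hb) : a ≠ 0)
      exact ⟨i, hb, rfl⟩
    refine ⟨Finset.univ.filter fun i => f i ∈ B, ?_, hBf⟩
    simp only [Finset.mem_filter, Finset.mem_univ, true_and]
    rw [← Finset.map_nonempty (f := f), hBf]
    exact hB.1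
  · intro A _
    rw [rename_linForm]

theorem prod_restrict_linForm_eq (hm : 1 ≤ m) (p : Fin (m + 2)) :
    ∏ B : Finset (Fin (m + 2)) with B.Nonempty ∧ p ∉ B, hyperplaneRestrict m (linForm B) =
      ∏ B : Finset (Fin (m + 2)) with B.Nonempty ∧ 0 ∉ B, hyperplaneRestrict m (linForm B) := by
  have hsign (B : Finset (Fin (m + 2))) : hyperplaneRestrict m (linForm B) =
      (if 0 ∈ B then -1 else 1) * hyperplaneRestrict m (linForm (if 0 ∈ B then Bᶜ else B)) := by
    split_ifs
    · rw [hyperplaneRestrict_linForm_compl, neg_one_mul, neg_neg]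
    · rw [one_mul]
  rw [Finset.prod_congr rfl fun B _ => hsign B, Finset.prod_mul_distrib]
  have h1 : ∏ B : Finset (Fin (m + 2)) with B.Nonempty ∧ p ∉ B,
      (if 0 ∈ B then -1 else 1 : MvPolynomial (Fin (m + 1)) ℂ) = 1 := by
    obtain ⟨q, hq⟩ : ∃ q, q ∉ ({0, p} : Finset (Fin (m + 2))) := by
      refine (Finset.exists_mem_notMem_of_card_lt_card (t := Finset.univ) ?_).imp fun _ h => h.2
      rw [Finset.card_univ, Fintype.card_fin]
      exact Finset.card_le_two.trans_lt (by omega)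
    rw [Finset.mem_insert, Finset.mem_singleton, not_or] at hq
    rw [Finset.prod_ite, Finset.prod_const_one, mul_one]
    refine Finset.prod_involution (fun B _ => symmDiff B {q}) (fun _ _ => by ring) ?_ ?_ ?_
    · intro B _ _ h
      simp at h
    · intro B hB
      simp only [Finset.mem_filter, Finset.mem_univ, true_and, Finset.mem_symmDiff,
        Finset.mem_singleton] at hB ⊢
      refine ⟨⟨⟨0, ?_⟩, ?_⟩, ?_⟩
      · simp [Finset.mem_symmDiff, hB.2, Ne.symm hq.1]
      · simp [hB.1.2, Ne.symm hq.2]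
      · simp [hB.2, Ne.symm hq.1]
    · intro B _
      simp
  rw [h1, one_mul]
  refine Finset.prod_bij (fun B _ => if 0 ∈ B then Bᶜ else B) ?_ ?_ ?_ ?_
  · intro B hB
    simp only [Finset.mem_filter, Finset.mem_univ, true_and] at hB ⊢
    split_ifs with h
    · exact ⟨⟨p, by simpa using hB.2⟩, by simpa using h⟩
    · exact ⟨hB.1, h⟩
  · intro B hB C hC h
    simp only [Finset.mem_filter, Finset.mem_univ, true_and] at hB hC
    split_ifs at h with h1 h2 h2
    · exact compl_injective h
    · exact absurd (h ▸ Finset.mem_compl.2 hB.2) hC.2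
    · exact absurd (h ▸ Finset.mem_compl.2 hC.2) hB.2
    · exact h
  · intro B hB
    simp only [Finset.mem_filter, Finset.mem_univ, true_and] at hB
    by_cases h : p ∈ B
    · refine ⟨Bᶜ, ?_, ?_⟩
      · simp only [Finset.mem_filter, Finset.mem_univ, true_and, Finset.mem_compl, not_not]
        exact ⟨⟨0, Finset.mem_compl.2 hB.2⟩, h⟩
      · simp [hB.2]
    · exact ⟨B, by simp [hB.1, h], by simp [hB.2]⟩
  · intro B _
    rfl

theorem hyperplaneRestrict_rename_arrangementPoly_eq (hm : 1 ≤ m) (σ : Equiv.Perm (Fin (m + 2))) :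
    hyperplaneRestrict m (rename σ (rename Fin.succ (arrangementPoly m))) = arrangementPoly m := by
  rw [hyperplaneRestrict_rename_arrangementPoly, prod_restrict_linForm_eq hm]
  have h := hyperplaneRestrict_rename_arrangementPoly (1 : Equiv.Perm (Fin (m + 2)))
  rw [Equiv.Perm.coe_one, rename_id_apply, hyperplaneRestrict_rename_succ] at h
  exact h.symm

theorem VanishesOnArrangement.exists_hyperplaneRestrict_eq (hm : 1 ≤ m)
    {F : MvPolynomial (Fin (m + 2)) ℂ} (hF : VanishesOnArrangement F) (hFs : F.IsSymmetric) :
    ∃ G : MvPolynomial (Fin (m + 2)) ℂ, G.IsSymmetric ∧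
      hyperplaneRestrict m F = arrangementPoly m * hyperplaneRestrict m G := by
  obtain ⟨H, hH⟩ : arrangementPoly m ∣ hyperplaneRestrict m F := by
    refine prod_linForm_dvd (fun A hA => (Finset.mem_filter.1 hA).2) fun A hA =>
      linForm_dvd (Finset.mem_filter.1 hA).2 fun x hx => ?_
    have hsum : ∑ i, (Fin.cons (-∑ i, x i) x : Fin (m + 2) → ℂ) i = 0 := by
      simp [Fin.sum_univ_succ]
    have h := eval_hyperplaneRestrict _ hsum F
    rw [Fin.tail_cons] at h
    rw [h]
    have hB : ∑ i ∈ A.map (Fin.succEmb (m + 1)),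
        (Fin.cons (-∑ i, x i) x : Fin (m + 2) → ℂ) i = 0 := by
      simpa using hx
    refine hF _ (A.map (Fin.succEmb (m + 1))) (Finset.mem_filter.1 hA).2.map ⟨0, ?_⟩ hB ?_
    · simp [Fin.succ_ne_zero]
    · rw [← Finset.sum_add_sum_compl (A.map (Fin.succEmb (m + 1))), hB, zero_add] at hsum
      exact hsum
  refine ⟨symmetrize (rename Fin.succ H), symmetrize_isSymmetric _, ?_⟩
  rw [map_symmetrize (H := H), hH]
  intro σ
  have h := hyperplaneRestrict_rename_lift σ F
  rw [hFs σ, hH, map_mul, map_mul, map_mul, hyperplaneRestrict_rename_arrangementPoly_eq hm] at h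
  exact mul_left_cancel₀ arrangementPoly_ne_zero h

theorem vanishesOnArrangement_of_dvd {F : MvPolynomial (Fin (m + 2)) ℂ}
    (hF : arrangementPoly m ∣ hyperplaneRestrict m F) : VanishesOnArrangement F := by
  intro x A hA hA' h1 h2
  have hx : ∑ i, x i = 0 := by rw [← Finset.sum_add_sum_compl A, h1, h2, add_zero]
  have key (B : Finset (Fin (m + 2))) (hB : B.Nonempty) (h0 : 0 ∉ B) (hBx : ∑ i ∈ B, x i = 0) :
      eval x F = 0 := by
    let C : Finset (Fin (m + 1)) := Finset.univ.filter fun i => i.succ ∈ B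
    have hCB : C.map (Fin.succEmb (m + 1)) = B := by
      ext b
      refine Fin.cases ?_ (fun b => ?_) b
      · simp [h0, Fin.succ_ne_zero]
      · simp [C]
    have hC : C.Nonempty := by
      rw [← Finset.map_nonempty (f := Fin.succEmb (m + 1)), hCB]
      exact hB
    obtain ⟨H, hH⟩ := (Finset.dvd_prod_of_mem linForm
      (Finset.mem_filter.2 ⟨Finset.mem_univ C, hC⟩)).trans hF
    rw [← eval_hyperplaneRestrict x hx, hH, map_mul, eval_linForm]
    rw [← hCB, Finset.sum_map] at hBx
    have : ∑ i ∈ C, Fin.tail x i = 0 := hBx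
    rw [this, zero_mul]
  by_cases h0 : 0 ∈ A
  · exact key Aᶜ hA' (by simpa using h0) h2
  · exact key A hA h0 h1

end Arrangement

section ArrangementDegree

variable {m : ℕ}

theorem lex_degree_linForm {A : Finset (Fin (m + 1))} {j : Fin (m + 1)} (hj : j ∈ A)
    (hA : ∀ i ∈ A, j ≤ i) : MonomialOrder.lex.degree (linForm A) = Finsupp.single j 1 := by
  refine MonomialOrder.lex.toSyn.injective (le_antisymm ?_ (MonomialOrder.le_degree ?_))
  · refine MonomialOrder.degree_sum_le.trans (Finset.sup_le fun i hi => ?_)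
    rw [MonomialOrder.degree_X, MonomialOrder.lex_le_iff]
    exact Finsupp.Lex.single_le_iff.2 (hA i hi)
  · rw [mem_support_iff, linForm, coeff_sum, Finset.sum_eq_single j]
    · simp
    · intro i _ hij
      rw [coeff_X, if_neg]
      intro h
      exact hij ((Finsupp.single_left_inj one_ne_zero).1 h)
    · exact fun h => absurd hj h

theorem card_filter_min_eq (j : Fin (m + 1)) :
    (Finset.univ.filter fun A : Finset (Fin (m + 1)) => j ∈ A ∧ ∀ i ∈ A, j ≤ i).card =
      2 ^ (m - j) := by
  have h : (Finset.univ.filter fun A : Finset (Fin (m + 1)) => j ∈ A ∧ ∀ i ∈ A, j ≤ i) =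
      (Finset.Ioi j).powerset.image (insert j) := by
    ext A
    simp only [Finset.mem_filter, Finset.mem_univ, true_and, Finset.mem_image, Finset.mem_powerset]
    constructor
    · rintro ⟨hj, hA⟩
      refine ⟨A.erase j, fun i hi => ?_, Finset.insert_erase hj⟩
      rw [Finset.mem_erase] at hi
      exact Finset.mem_Ioi.2 (lt_of_le_of_ne (hA i hi.2) (Ne.symm hi.1))
    · rintro ⟨B, hB, rfl⟩
      refine ⟨Finset.mem_insert_self _ _, fun i hi => ?_⟩
      rcases Finset.mem_insert.1 hi with rfl | hi
      · exact le_rfl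
      · exact (Finset.mem_Ioi.1 (hB hi)).le
  rw [h, Finset.card_image_of_injOn, Finset.card_powerset, Fin.card_Ioi]
  · simp
  · intro B hB C hC hBC
    have hj {B : Finset (Fin (m + 1))}
        (hB : B ∈ ((Finset.Ioi j).powerset : Set (Finset (Fin (m + 1))))) :
        j ∉ B := fun h => lt_irrefl j (Finset.mem_Ioi.1 (Finset.mem_powerset.1 hB h))
    rw [← Finset.erase_insert (hj hB), ← Finset.erase_insert (hj hC)]
    exact congrArg (fun s => s.erase j) hBC

theorem lex_degree_arrangementPoly (j : Fin (m + 1)) :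
    MonomialOrder.lex.degree (arrangementPoly m) j = 2 ^ (m - j) := by
  rw [arrangementPoly, MonomialOrder.degree_prod fun A hA =>
    linForm_ne_zero (Finset.mem_filter.1 hA).2, Finsupp.finsetSum_apply, ← card_filter_min_eq,
    Finset.card_eq_sum_ones, Finset.sum_filter, Finset.sum_filter]
  refine Finset.sum_congr rfl fun A _ => ?_
  by_cases hA : A.Nonempty
  · rw [if_pos hA, lex_degree_linForm (A.min'_mem hA) fun i hi => A.min'_le i hi,
      Finsupp.single_apply]
    refine if_congr ⟨?_, ?_⟩ rfl rfl
    · rintro rfl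
      exact ⟨A.min'_mem hA, fun i hi => A.min'_le i hi⟩
    · rintro ⟨h1, h2⟩
      exact le_antisymm (A.min'_le j h1) (h2 _ (A.min'_mem hA))
  · rw [if_neg hA, if_neg]
    exact fun h => hA ⟨j, h.1⟩

theorem accumulate_nvec (hm : 1 ≤ m) {j : ℕ} (hj : 1 ≤ j) (hjm : j ≤ m) :
    Fin.accumulate (m + 1) (m + 1) (nvec (m + 2)) ⟨j, by omega⟩ = 2 ^ (m - j) := by
  induction hd : m - j generalizing j with
  | zero =>
    obtain rfl : j = m := by omega
    rw [Fin.accumulate_last (by omega) rfl]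
    · simp [nvec, show j ≠ 0 by omega]
    · intro i hi
      omega
  | succ d ih =>
    rw [Fin.accumulate_rec (by omega) (by omega), ih (by omega) (by omega) (by omega)]
    have : nvec (m + 2) ⟨j, by omega⟩ = 2 ^ d := by
      rw [nvec]
      dsimp only
      rw [if_neg (by omega), if_neg (by omega)]
      congr 1
      omega
    rw [this]
    ring

/-- The exponent `(0, h₂, …, hₙ)` with `(h₂, …, hₙ) = 𝐧`. -/
def arrangementExponent (m : ℕ) : Fin (m + 2) →₀ ℕ :=
  Finsupp.equivFunOnFinite.symm (extend0 (nvec (m + 2)))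

theorem arrangementExponent_zero : arrangementExponent m 0 = 0 := rfl

theorem hyperplaneDegree_arrangementExponent (hm : 1 ≤ m) :
    hyperplaneDegree m (arrangementExponent m) = MonomialOrder.lex.degree (arrangementPoly m) := by
  ext j
  rw [lex_degree_arrangementPoly, hyperplaneDegree_apply]
  have h : (fun i : Fin (m + 1) => arrangementExponent m i.succ) = nvec (m + 2) := rfl
  rw [h]
  obtain ⟨j, hj⟩ := j
  rcases Nat.eq_zero_or_pos j with rfl | hj0
  · rw [Fin.accumulate_rec (by omega) (by omega), accumulate_nvec hm le_rfl hm]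
    obtain ⟨m, rfl⟩ : ∃ l, m = l + 1 := ⟨m - 1, by omega⟩
    simp [nvec, pow_succ']
  · rw [if_neg, one_mul, accumulate_nvec hm hj0 (by omega)]
    intro h
    rw [Fin.ext_iff] at h
    exact hj0.ne' h

end ArrangementDegree

section EsymmExpansion

theorem mem_wtT {n g : ℕ} (k : Fin n → ℕ) : k ∈ wtT n g ↔ ∑ i : Fin n, ((i : ℕ) + 1) * k i = g := by
  rw [wtT, Finset.mem_filter, Fintype.mem_piFinset, and_iff_right_iff_imp]
  rintro rfl i
  rw [Finset.mem_range, Nat.lt_succ_iff]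
  exact (Nat.le_mul_of_pos_left _ (Nat.succ_pos _)).trans
    (Finset.single_le_sum (f := fun i : Fin n => ((i : ℕ) + 1) * k i) (fun _ _ => Nat.zero_le _)
      (Finset.mem_univ i))

variable {n g : ℕ} {U : (Fin n → ℕ) → MvPolynomial ℕ ℂ}

theorem dualPoly_eq_evalEsymm
    (hU : pot n g = ∑ k ∈ wtT n g,
      (∏ i : Fin n, esymm (Fin n) ℂ ((i : ℕ) + 1) ^ k i) ⊗ₜ[ℂ] U k)
    (ψ : MvPolynomial ℕ ℂ →ₗ[ℂ] ℂ) :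
    dualPoly ψ n g =
      evalEsymm n (∑ k ∈ wtT n g, monomial (Finsupp.equivFunOnFinite.symm k) (ψ (U k))) := by
  let Λ : MvPolynomial (Fin n) ℂ ⊗[ℂ] MvPolynomial ℕ ℂ →ₗ[ℂ] MvPolynomial (Fin n) ℂ :=
    (TensorProduct.rid ℂ _).toLinearMap ∘ₗ LinearMap.lTensor _ ψ
  have hΛ (p : MvPolynomial (Fin n) ℂ) (q : MvPolynomial ℕ ℂ) : Λ (p ⊗ₜ q) = ψ q • p := rfl
  have h := congrArg Λ hU
  rw [pot, map_sum, map_sum] at h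
  simp only [hΛ] at h
  simp only [map_sum, evalEsymm_monomial, Finsupp.coe_equivFunOnFinite_symm]
  rw [← h, dualPoly]
  refine Finset.sum_nbij' (fun r => ⇑r) (fun r => Finsupp.equivFunOnFinite.symm r) ?_ ?_ ?_ ?_ ?_
  · intro r hr
    rwa [Finset.Nat.mem_antidiagonalTuple, ← mem_finsuppAntidiag_univ]
  · intro r hr
    rwa [mem_finsuppAntidiag_univ, ← Finset.Nat.mem_antidiagonalTuple]
  · intro r _
    exact Finsupp.equivFunOnFinite.symm_apply_apply r
  · intro r _
    rfl
  · intro r _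
    rw [tupleMonomial, monomial_eq, smul_eq_C_mul, Finsupp.prod_fintype _ _ (by simp)]

theorem coeff_sum_monomial_wtT (f : (Fin n → ℕ) → ℂ) (k : Fin n →₀ ℕ) :
    coeff k (∑ l ∈ wtT n g, monomial (Finsupp.equivFunOnFinite.symm l) (f l)) =
      if ∑ i : Fin n, ((i : ℕ) + 1) * k i = g then f k else 0 := by
  classical
  rw [coeff_sum]
  have h (l : Fin n → ℕ) : coeff k (monomial (Finsupp.equivFunOnFinite.symm l) (f l)) =
      if l = k then f l else 0 := by
    rw [coeff_monomial]
    exact if_congr (Equiv.symm_apply_eq _) rfl rfl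
  simp only [h, Finset.sum_ite_eq', mem_wtT]

theorem evalEsymm_monomial_isHomogeneous (k : Fin n →₀ ℕ) :
    (evalEsymm n (monomial k 1)).IsHomogeneous (∑ i : Fin n, ((i : ℕ) + 1) * k i) := by
  rw [evalEsymm_monomial, one_smul]
  refine IsHomogeneous.prod _ _ _ fun i _ => IsHomogeneous.pow ?_ _
  refine IsHomogeneous.sum _ _ _ fun A hA => ?_
  rw [← (Finset.mem_powersetCard.1 hA).2, Finset.card_eq_sum_ones]
  exact IsHomogeneous.prod _ _ _ fun _ _ => isHomogeneous_X _ _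

end EsymmExpansion

section Restriction

variable {m : ℕ}

theorem hyperplaneRestrict_isHomogeneous {F : MvPolynomial (Fin (m + 2)) ℂ} {d : ℕ}
    (hF : F.IsHomogeneous d) : (hyperplaneRestrict m F).IsHomogeneous d := by
  rw [← one_mul d]
  refine IsHomogeneous.aeval hF (Fin.cons (-linForm Finset.univ) X) fun i => ?_
  refine Fin.cases ?_ (fun i => ?_) i
  · rw [Fin.cons_zero]
    exact (IsHomogeneous.sum _ _ _ fun _ _ => isHomogeneous_X _ _).neg
  · rw [Fin.cons_succ]
    exact isHomogeneous_X _ _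

theorem exists_lex_degree_hyperplaneRestrict_evalEsymm {p : MvPolynomial (Fin (m + 2)) ℂ}
    (hp : hyperplaneRestrict m (evalEsymm (m + 2) p) ≠ 0) :
    ∃ k ∈ p.support, k 0 = 0 ∧
      MonomialOrder.lex.degree (hyperplaneRestrict m (evalEsymm (m + 2) p)) = hyperplaneDegree m k ∧
      ∀ l ∈ p.support, l 0 = 0 → MonomialOrder.lex.toSyn (hyperplaneDegree m l) ≤
        MonomialOrder.lex.toSyn (hyperplaneDegree m k) := by
  refine (lex_degree_hyperplaneRestrict_evalEsymm ?_).2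
  by_contra! h
  refine hp ?_
  rw [hyperplaneRestrict_evalEsymm_eq_sum, Finset.filter_false_of_mem h, Finset.sum_empty]

theorem hyperplaneRestrict_dualPoly_eq_zero_iff (ψ : MvPolynomial ℕ ℂ →ₗ[ℂ] ℂ) (g : ℕ) :
    hyperplaneRestrict m (dualPoly ψ (m + 2) g) = 0 ↔
      ∀ x : Fin (m + 2) → ℂ, ∑ i, x i = 0 → ψ (potAt x g) = 0 := by
  refine ⟨fun h x hx => ?_, fun h => MvPolynomial.funext fun y => ?_⟩
  · rw [← eval_dualPoly, ← eval_hyperplaneRestrict x hx, h, map_zero]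
  · have hx : ∑ i, (Fin.cons (-∑ i, y i) y : Fin (m + 2) → ℂ) i = 0 := by
      rw [Fin.sum_univ_succ, Fin.cons_zero]
      simp
    have h1 := eval_hyperplaneRestrict _ hx (dualPoly ψ (m + 2) g)
    rw [Fin.tail_cons, eval_dualPoly, h _ hx] at h1
    rw [h1, map_zero]

theorem weight_extend0 (k : Fin (m + 1) → ℕ) :
    ∑ i : Fin (m + 2), ((i : ℕ) + 1) * extend0 (n := m + 2) k i =
      ∑ i : Fin (m + 1), ((i : ℕ) + 2) * k i := by
  rw [Fin.sum_univ_succ]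
  exact Nat.zero_add _

theorem extend0_comp_succ {K : Fin (m + 2) → ℕ} (hK : K 0 = 0) :
    extend0 (n := m + 2) (fun i : Fin (m + 1) => K i.succ) = K := by
  funext i
  refine Fin.cases ?_ (fun i => ?_) i
  · exact hK.symm
  · rfl

theorem arrangementExponent_le_iff (k : Fin (m + 1) → ℕ) :
    arrangementExponent m ≤ Finsupp.equivFunOnFinite.symm (extend0 (n := m + 2) k) ↔
      nvec (m + 2) ≤ k := by
  refine ⟨fun h i => h i.succ, fun h i => ?_⟩
  refine Fin.cases ?_ (fun i => ?_) i
  · exact le_rfl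
  · exact h i

theorem arrangementPoly_isHomogeneous_weight (hm : 1 ≤ m) :
    (arrangementPoly m).IsHomogeneous
      (∑ i : Fin (m + 2), ((i : ℕ) + 1) * arrangementExponent m i) := by
  have h (d : ℕ) (Q : MvPolynomial (Fin (m + 1)) ℂ) (hQ : Q ≠ 0) (hd : Q.IsHomogeneous d)
      (hl : MonomialOrder.lex.degree Q = hyperplaneDegree m (arrangementExponent m)) :
      (hyperplaneDegree m (arrangementExponent m)).degree = d := by
    rw [← hl]
    by_contra hne
    exact MonomialOrder.coeff_degree_ne_zero_iff.2 hQ (hd.coeff_eq_zero hne)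
  obtain ⟨h1, h2⟩ :=
    lex_degree_hyperplaneRestrict_evalEsymm_monomial (arrangementExponent_zero (m := m))
  rw [← h _ _ h1 (hyperplaneRestrict_isHomogeneous (evalEsymm_monomial_isHomogeneous _)) h2,
    h _ _ arrangementPoly_ne_zero arrangementPoly_isHomogeneous
      (hyperplaneDegree_arrangementExponent hm).symm]
  exact arrangementPoly_isHomogeneous

theorem exists_evalEsymm_leading (hm : 1 ≤ m) :
    ∃ p : MvPolynomial (Fin (m + 2)) ℂ,
      hyperplaneRestrict m (evalEsymm (m + 2) p) = arrangementPoly m ∧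
      (evalEsymm (m + 2) p).IsHomogeneous
        (∑ i : Fin (m + 2), ((i : ℕ) + 1) * arrangementExponent m i) ∧
      coeff (arrangementExponent m) p ≠ 0 ∧
      ∀ l ∈ p.support, l 0 = 0 → MonomialOrder.lex.toSyn (hyperplaneDegree m l) ≤
        MonomialOrder.lex.toSyn (hyperplaneDegree m (arrangementExponent m)) := by
  obtain ⟨p, hp⟩ :=
    exists_evalEsymm_eq (symmetrize_isSymmetric (rename Fin.succ (arrangementPoly m)))
  have hr : hyperplaneRestrict m (evalEsymm (m + 2) p) = arrangementPoly m := by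
    rw [hp]
    exact map_symmetrize _ (hyperplaneRestrict_rename_arrangementPoly_eq hm)
  obtain ⟨k, hk, hk0, hkd, hkl⟩ := exists_lex_degree_hyperplaneRestrict_evalEsymm
    (p := p) (by rw [hr]; exact arrangementPoly_ne_zero)
  rw [hr, ← hyperplaneDegree_arrangementExponent hm] at hkd
  obtain rfl := eq_of_hyperplaneDegree_eq (arrangementExponent_zero.trans hk0.symm) hkd
  refine ⟨p, hr, ?_, mem_support_iff.1 hk, hkl⟩
  rw [hp]
  exact symmetrize_isHomogeneous (arrangementPoly_isHomogeneous_weight hm).rename_isHomogeneous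

end Restriction

section Basis

variable {D : Derivation ℂ (MvPolynomial ℕ ℂ) (MvPolynomial ℕ ℂ)} {m g : ℕ}
  {U : (Fin (m + 2) → ℕ) → MvPolynomial ℕ ℂ}

theorem mem_Sng_of_pot_eq (hD0 : D (X 0) = 0) (hD : ∀ i : ℕ, D (X (i + 1)) = X i)
    (hU : pot (m + 2) g = ∑ k ∈ wtT (m + 2) g,
      (∏ i : Fin (m + 2), esymm (Fin (m + 2)) ℂ ((i : ℕ) + 1) ^ k i) ⊗ₜ[ℂ] U k)
    {K : Fin (m + 2) → ℕ} (hK0 : K 0 = 0)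
    (hK : ∑ i : Fin (m + 2), ((i : ℕ) + 1) * K i = g) : U K ∈ Sng D (m + 2) g := by
  have hle : Submodule.span ℂ {p | ∃ x : Fin (m + 2) → ℂ, ∑ i, x i = 0 ∧ p = potAt x g} ≤
      Sng D (m + 2) g := by
    refine Submodule.span_le.2 ?_
    rintro _ ⟨x, hx, rfl⟩
    exact potAt_mem_Sng hD0 hD x hx g
  refine hle ?_
  by_contra hmem
  obtain ⟨ψ, hψ, hker⟩ := Submodule.exists_le_ker_of_notMem hmem
  have h0 : hyperplaneRestrict m (dualPoly ψ (m + 2) g) = 0 :=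
    (hyperplaneRestrict_dualPoly_eq_zero_iff ψ g).2 fun x hx =>
      hker (Submodule.subset_span ⟨x, hx, rfl⟩)
  rw [dualPoly_eq_evalEsymm hU] at h0
  refine (lex_degree_hyperplaneRestrict_evalEsymm
    ⟨Finsupp.equivFunOnFinite.symm K, ?_, hK0⟩).1 h0
  rw [mem_support_iff, coeff_sum_monomial_wtT, Finsupp.coe_equivFunOnFinite_symm, if_pos hK]
  exact hψ

theorem Sng_le_Dec_sup_span (hD0 : D (X 0) = 0) (hD : ∀ i : ℕ, D (X (i + 1)) = X i)
    (hm : 1 ≤ m) (hU : pot (m + 2) g = ∑ k ∈ wtT (m + 2) g,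
      (∏ i : Fin (m + 2), esymm (Fin (m + 2)) ℂ ((i : ℕ) + 1) ^ k i) ⊗ₜ[ℂ] U k) :
    Sng D (m + 2) g ≤ Dec D (m + 2) g ⊔
      Submodule.span ℂ
        {x : MvPolynomial ℕ ℂ | ∃ k : Fin (m + 1) → ℕ,
          (∑ i : Fin (m + 1), ((i : ℕ) + 2) * k i = g) ∧ nvec (m + 2) ≤ k ∧
            x = U (extend0 (n := m + 2) k)} := by
  intro s hs
  by_contra hmem
  obtain ⟨ψ, hψs, hker⟩ := Submodule.exists_le_ker_of_notMem hmem
  obtain ⟨hDec, hspan⟩ := sup_le_iff.1 hker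
  have hr : hyperplaneRestrict m (dualPoly ψ (m + 2) g) = 0 := by
    by_contra hne
    obtain ⟨G, hGs, hG⟩ := (dualPoly_vanishesOnArrangement hD0 hD hDec).exists_hyperplaneRestrict_eq
      hm (dualPoly_isSymmetric ψ (m + 2) g)
    obtain ⟨q, rfl⟩ := exists_evalEsymm_eq hGs
    have hq : hyperplaneRestrict m (evalEsymm (m + 2) q) ≠ 0 := by
      rintro h
      rw [hG, h, mul_zero] at hne
      exact hne rfl
    obtain ⟨l, -, hl0, hld, -⟩ := exists_lex_degree_hyperplaneRestrict_evalEsymm hq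
    have hdeg := MonomialOrder.degree_mul (m := MonomialOrder.lex) arrangementPoly_ne_zero hq
    rw [← hG, hld, ← hyperplaneDegree_arrangementExponent hm, ← map_add] at hdeg
    rw [dualPoly_eq_evalEsymm hU] at hne hdeg
    obtain ⟨k, hk, hk0, hkd, -⟩ := exists_lex_degree_hyperplaneRestrict_evalEsymm hne
    have hkl : k = arrangementExponent m + l := by
      refine eq_of_hyperplaneDegree_eq ?_ (hkd.symm.trans hdeg)
      rw [hk0, Finsupp.add_apply, hl0, arrangementExponent_zero]
    rw [mem_support_iff, coeff_sum_monomial_wtT, ite_ne_right_iff] at hk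
    refine hk.2 (hspan (Submodule.subset_span ⟨fun i => k i.succ, ?_, fun i => ?_, ?_⟩))
    · rw [← weight_extend0, extend0_comp_succ hk0, hk.1]
    · exact le_of_le_of_eq (Nat.le_add_right _ (l i.succ)) (DFunLike.congr_fun hkl i.succ).symm
    · rw [extend0_comp_succ hk0]
  refine hψs (show s ∈ LinearMap.ker ψ from ?_)
  refine Submodule.span_le.2 ?_ (Sng_le_span_potAt hD0 hD (Nat.succ_pos _) g hs)
  rintro _ ⟨x, hx, rfl⟩
  exact (hyperplaneRestrict_dualPoly_eq_zero_iff ψ g).1 hr x hx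

theorem exists_functional_apply (hD0 : D (X 0) = 0) (hD : ∀ i : ℕ, D (X (i + 1)) = X i)
    (hm : 1 ≤ m) (hU : pot (m + 2) g = ∑ k ∈ wtT (m + 2) g,
      (∏ i : Fin (m + 2), esymm (Fin (m + 2)) ℂ ((i : ℕ) + 1) ^ k i) ⊗ₜ[ℂ] U k)
    {K : Fin (m + 2) →₀ ℕ} (hK : ∑ i : Fin (m + 2), ((i : ℕ) + 1) * K i = g)
    (hle : arrangementExponent m ≤ K) :
    ∃ ψ : MvPolynomial ℕ ℂ →ₗ[ℂ] ℂ, Dec D (m + 2) g ≤ LinearMap.ker ψ ∧ ψ (U K) ≠ 0 ∧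
      ∀ L : Fin (m + 2) →₀ ℕ, L 0 = 0 → ∑ i : Fin (m + 2), ((i : ℕ) + 1) * L i = g →
        ψ (U L) ≠ 0 → MonomialOrder.lex.toSyn (hyperplaneDegree m L) ≤
          MonomialOrder.lex.toSyn (hyperplaneDegree m K) := by
  obtain ⟨l, rfl⟩ := exists_add_of_le hle
  obtain ⟨p, hr, hh, hc, hlead⟩ := exists_evalEsymm_leading hm
  let F := evalEsymm (m + 2) (p * monomial l 1)
  have hFs : F.IsSymmetric := evalEsymm_isSymmetric _
  have hFh : F.IsHomogeneous g := by
    have h := hh.mul (evalEsymm_monomial_isHomogeneous l)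
    rw [← Finset.sum_add_distrib] at h
    simp only [← mul_add, ← Finsupp.add_apply] at h
    rwa [← map_mul, hK] at h
  have hdual := dualPoly_coeffFunctional hFs hFh
  have hcoeff (L : Fin (m + 2) →₀ ℕ) (hL : ∑ i : Fin (m + 2), ((i : ℕ) + 1) * L i = g) :
      coeffFunctional F (U L) = coeff L (p * monomial l 1) := by
    rw [dualPoly_eq_evalEsymm hU] at hdual
    rw [← evalEsymm_injective _ hdual, coeff_sum_monomial_wtT, if_pos hL]
  refine ⟨coeffFunctional F, ?_, ?_, fun L hL0 hL hne => ?_⟩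
  · refine Dec_le_ker hD0 hD ?_
    rw [hdual]
    refine vanishesOnArrangement_of_dvd ?_
    rw [show F = _ from map_mul _ _ _, map_mul, hr]
    exact dvd_mul_right _ _
  · rw [hcoeff _ hK, coeff_mul_monomial, mul_one]
    exact hc
  · rw [hcoeff L hL, coeff_mul_monomial', ite_ne_right_iff, mul_one] at hne
    obtain ⟨h1, h2⟩ := hne
    have h3 := hlead (L - l) (mem_support_iff.2 h2) (by
      rw [Finsupp.tsub_apply, hL0, Nat.zero_sub])
    have h4 := add_le_add_left h3 (MonomialOrder.lex.toSyn (hyperplaneDegree m l))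
    rwa [← map_add, ← map_add, ← map_add, ← map_add, tsub_add_cancel_of_le h1] at h4

theorem eq_zero_of_sum_smul_mem_Dec (hD0 : D (X 0) = 0) (hD : ∀ i : ℕ, D (X (i + 1)) = X i)
    (hm : 1 ≤ m) (hU : pot (m + 2) g = ∑ k ∈ wtT (m + 2) g,
      (∏ i : Fin (m + 2), esymm (Fin (m + 2)) ℂ ((i : ℕ) + 1) ^ k i) ⊗ₜ[ℂ] U k)
    (c : (Fin (m + 1) → ℕ) →₀ ℂ)
    (hc : ∀ k ∈ c.support,
      (∑ i : Fin (m + 1), ((i : ℕ) + 2) * k i = g) ∧ nvec (m + 2) ≤ k)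
    (hsum : (c.sum fun k a => a • U (extend0 (n := m + 2) k)) ∈ Dec D (m + 2) g) : c = 0 := by
  by_contra hne
  let e : (Fin (m + 1) → ℕ) → (Fin (m + 2) →₀ ℕ) := fun k =>
    Finsupp.equivFunOnFinite.symm (extend0 (n := m + 2) k)
  obtain ⟨k, hk, hmin⟩ := c.support.exists_min_image
    (fun k => MonomialOrder.lex.toSyn (hyperplaneDegree m (e k)))
    (Finsupp.support_nonempty_iff.2 hne)
  have he (l) (hl : l ∈ c.support) : ∑ i : Fin (m + 2), ((i : ℕ) + 1) * e l i = g :=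
    (weight_extend0 l).trans (hc l hl).1
  obtain ⟨ψ, hker, hψ, hψ'⟩ := exists_functional_apply hD0 hD hm hU (he k hk)
    ((arrangementExponent_le_iff k).2 (hc k hk).2)
  have h := hker hsum
  rw [LinearMap.mem_ker, Finsupp.sum, map_sum, Finset.sum_eq_single_of_mem k hk, map_smul,
    smul_eq_mul] at h
  · exact (mul_ne_zero (Finsupp.mem_support_iff.1 hk) hψ) h
  · intro l hl hlk
    rw [map_smul]
    by_contra h0
    refine hlk ?_
    have h1 := hψ' (e l) rfl (he l hl) (right_ne_zero_of_smul h0)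
    have h2 : e l = e k := eq_of_hyperplaneDegree_eq rfl
      (MonomialOrder.lex.toSyn.injective (le_antisymm h1 (hmin l hl)))
    funext i
    exact DFunLike.congr_fun h2 i.succ

end Basis

/-- for `n ≥ 3`, the residue classes of the `U_{k₂,…,kₙ}` (from the
expansion of the potenziante in the elementary symmetric monomials, with first index
`0`) with `(k₂,…,kₙ) ⪰ 𝐧` and `2k₂+⋯+nkₙ = g` form a ℂ-basis of `S_{n,g}/Dec_{n,g}`:
they are linearly independent modulo `Dec_{n,g}` and, together with `Dec_{n,g}`,
they span `S_{n,g}`. -/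
theorem stmt14
    (D : Derivation ℂ (MvPolynomial ℕ ℂ) (MvPolynomial ℕ ℂ))
    (hD0 : D (X 0) = 0) (hD : ∀ i : ℕ, D (X (i + 1)) = X i)
    (n : ℕ) (hn : 3 ≤ n) (U : (Fin n → ℕ) → MvPolynomial ℕ ℂ)
    (hU : ∀ g : ℕ, pot n g =
      ∑ k ∈ wtT n g,
        (∏ i : Fin n, esymm (Fin n) ℂ ((i : ℕ) + 1) ^ k i) ⊗ₜ[ℂ] U k)
    (g : ℕ) :
    (∀ c : (Fin (n - 1) → ℕ) →₀ ℂ,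
      (∀ k ∈ c.support,
        (∑ i : Fin (n - 1), ((i : ℕ) + 2) * k i = g) ∧ nvec n ≤ k) →
      (c.sum fun k a => a • U (extend0 k)) ∈ Dec D n g → c = 0) ∧
    Sng D n g = Dec D n g ⊔
      Submodule.span ℂ
        {x : MvPolynomial ℕ ℂ | ∃ k : Fin (n - 1) → ℕ,
          (∑ i : Fin (n - 1), ((i : ℕ) + 2) * k i = g) ∧ nvec n ≤ k ∧
            x = U (extend0 k)} := by
  obtain ⟨m, rfl⟩ : ∃ m, n = m + 2 := ⟨n - 2, by omega⟩
  have hm : 1 ≤ m := by omega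
  refine ⟨fun c hc hsum => eq_zero_of_sum_smul_mem_Dec hD0 hD hm (hU g) c hc hsum,
    le_antisymm (Sng_le_Dec_sup_span hD0 hD hm (hU g)) ?_⟩
  refine sup_le (Dec_le_Sng (m + 2) g) (Submodule.span_le.2 ?_)
  rintro _ ⟨k, hk, -, rfl⟩
  exact mem_Sng_of_pot_eq hD0 hD (hU g) rfl ((weight_extend0 k).trans hk)
end
end

section
/- For n ≥ 2, the map (h₂,…,hₙ) ↦ ℓexp(ē₂^{h₂}⋯ēₙ^{hₙ}) from ℕ^{n−1} to ℕ^{n−1} is injective, and its image consists exactly of the vectors (r₁,…,r_{n−1}) such that r₁ − 2r₂ is a nonnegative even integer and rᵢ ≥ r_{i+1} for 2 ≤ i ≤ n−2. -/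
open MvPolynomial

noncomputable section

/-- `λ̄ᵢ` (`i = 1,…,n`) in `Aₙ = ℂ[λ₁,…,λₙ]/(λ₁+⋯+λₙ)`, identified with the polynomial
ring `ℂ[λ̄₁,…,λ̄_{n-1}]` via `λ̄ₙ = −(λ̄₁+⋯+λ̄_{n-1})`. -/
def lamb (n : ℕ) (i : Fin n) : MvPolynomial (Fin (n - 1)) ℂ :=
  if h : (i : ℕ) < n - 1 then X ⟨(i : ℕ), h⟩ else -(∑ j : Fin (n - 1), X j)

/-- `ēⱼ`: the image in `ℂ[λ̄₁,…,λ̄_{n-1}]` of the `j`-th elementary symmetric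
polynomial `eⱼ(λ₁,…,λₙ)`. -/
def ebar (n j : ℕ) : MvPolynomial (Fin (n - 1)) ℂ :=
  ∑ T ∈ Finset.powersetCard j (Finset.univ : Finset (Fin n)), ∏ i ∈ T, lamb n i

/-- `u ≤ v` in the lexicographic order on exponent vectors. -/
def lexLe {m : ℕ} (u v : Fin m → ℕ) : Prop :=
  u = v ∨ ∃ i : Fin m, u i < v i ∧ ∀ j : Fin m, j < i → u j = v j

/-- `v` is the leading exponent (`ℓexp`) of `f` for the lexicographic order:
the monomial with exponent `v` occurs in `f`, and every exponent occurring in `f`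
is lexicographically `≤ v`. -/
def IsLeadExp {m : ℕ} (f : MvPolynomial (Fin m) ℂ) (v : Fin m → ℕ) : Prop :=
  coeff (Finsupp.equivFunOnFinite.symm v) f ≠ 0 ∧
    ∀ d ∈ f.support, lexLe (⇑d) v

/-- Extension of an exponent vector `(r₁,…,r_{n-1})` by zeros. -/
def rext {m : ℕ} (r : Fin m → ℕ) (i : ℕ) : ℕ :=
  if h : i < m then r ⟨i, h⟩ else 0

open scoped MonomialOrder in
theorem IsLeadExp.degree_lex_eq {m : ℕ} {f : MvPolynomial (Fin m) ℂ} {v : Fin m → ℕ}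
    (h : IsLeadExp f v) : ⇑(MonomialOrder.lex.degree f) = v := by
  have key : MonomialOrder.lex.degree f = Finsupp.equivFunOnFinite.symm v := by
    apply MonomialOrder.lex.toSyn.injective
    apply le_antisymm
    · rw [MonomialOrder.degree_le_iff]
      intro d hd
      rw [MonomialOrder.lex_le_iff]
      rcases h.2 d hd with hdv | ⟨i, hi, hlt⟩
      · rw [← hdv]
        simp
      · exact le_of_lt ⟨i, hlt, hi⟩
    · exact MonomialOrder.le_degree (mem_support_iff.2 h.1)
  rw [key]
  rfl

theorem degree_lex_esymm_apply {m : ℕ} (i : ℕ) (hi : i < m) (k : Fin m) :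
    MonomialOrder.lex.degree (esymm (Fin m) ℂ (i + 1)) k = if (k : ℕ) ≤ i then 1 else 0 := by
  have h := congrFun (supDegree_esymm (R := ℂ) (n := m) (m := m) (i := ⟨i, hi⟩) hi) k
  have hdeg : MonomialOrder.lex.degree (esymm (Fin m) ℂ (i + 1)) =
      ofLex (AddMonoidAlgebra.supDegree toLex (esymm (Fin m) ℂ (i + 1))) := rfl
  rw [hdeg, h]
  simp [Fin.accumulate_apply, Finsupp.single_apply]
  rfl

theorem esymm_succ_ne_zero {m : ℕ} (i : ℕ) (hi : i < m) : esymm (Fin m) ℂ (i + 1) ≠ 0 := by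
  intro h
  simpa [h] using degree_lex_esymm_apply i hi ⟨0, by omega⟩

theorem ebar_succ_eq (m j : ℕ) :
    ebar (m + 1) (j + 1) = esymm (Fin m) ℂ (j + 1) - esymm (Fin m) ℂ 1 * esymm (Fin m) ℂ j := by
  have h1 : ebar (m + 1) (j + 1) =
      (((Finset.univ : Finset (Fin (m + 1))).val.map (lamb (m + 1))).esymm (j + 1)) := by
    rw [Finset.esymm_map_val]
    rfl
  have h2 : (Finset.univ : Finset (Fin (m + 1))).val.map (lamb (m + 1)) =
      (-(esymm (Fin m) ℂ 1)) ::ₘ (Finset.univ : Finset (Fin m)).val.map X := by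
    rw [Fin.univ_castSuccEmb]
    simp [lamb, esymm_one, Function.comp_def]
  rw [h1, h2, Multiset.esymm, Multiset.powersetCard_cons, Multiset.map_add, Multiset.sum_add,
    Multiset.map_map, esymm_eq_multiset_esymm, sub_eq_add_neg, ← neg_mul]
  simp only [Multiset.esymm, Function.comp_def, Multiset.prod_cons, Multiset.sum_map_mul_left]

open scoped MonomialOrder in
theorem degree_lex_ebar {m : ℕ} (i : Fin m) :
    ebar (m + 1) ((i : ℕ) + 2) ≠ 0 ∧ ∀ k : Fin m,
      MonomialOrder.lex.degree (σ := Fin m) (ebar (m + 1) ((i : ℕ) + 2)) k =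
        (if (k : ℕ) ≤ i then 1 else 0) + if (k : ℕ) = 0 then 1 else 0 := by
  have hm : 0 < m := i.pos
  set p := esymm (Fin m) ℂ (0 + 1) * esymm (Fin m) ℂ ((i : ℕ) + 1) with hp
  have hdeg : ∀ k : Fin m, MonomialOrder.lex.degree p k =
      (if (k : ℕ) ≤ i then 1 else 0) + if (k : ℕ) = 0 then 1 else 0 := by
    intro k
    rw [hp, MonomialOrder.degree_mul (esymm_succ_ne_zero 0 hm) (esymm_succ_ne_zero i i.2),
      Finsupp.add_apply, degree_lex_esymm_apply 0 hm, degree_lex_esymm_apply i i.2, add_comm]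
    simp
  have hlt : MonomialOrder.lex.degree (esymm (Fin m) ℂ ((i : ℕ) + 2)) ≺[MonomialOrder.lex]
      MonomialOrder.lex.degree (-p) := by
    rw [MonomialOrder.lex_lt_iff, MonomialOrder.degree_neg]
    refine ⟨⟨0, hm⟩, fun j hj => absurd hj (by simp [Fin.lt_def]), ?_⟩
    simp only [ofLex_toLex]
    rw [hdeg]
    by_cases hi : (i : ℕ) + 1 < m
    · rw [degree_lex_esymm_apply _ hi]
      simp
    · have h0 : esymm (Fin m) ℂ ((i : ℕ) + 2) = 0 := by
        rw [esymm, Finset.powersetCard_eq_empty.2 (by simp; omega), Finset.sum_empty]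
      simp [h0]
  have he : ebar (m + 1) ((i : ℕ) + 2) = -p + esymm (Fin m) ℂ ((i : ℕ) + 2) := by
    rw [ebar_succ_eq, hp]
    ring
  have hd : MonomialOrder.lex.degree (σ := Fin m) (ebar (m + 1) ((i : ℕ) + 2)) =
      MonomialOrder.lex.degree p := by
    rw [he, MonomialOrder.degree_add_of_lt hlt, MonomialOrder.degree_neg]
  refine ⟨fun h => ?_, fun k => by rw [hd, hdeg]⟩
  have h0 := hdeg ⟨0, hm⟩
  rw [← hd, h] at h0
  simp at h0

theorem degree_lex_prod_ebar {m : ℕ} (h : Fin m → ℕ) (k : Fin m) :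
    MonomialOrder.lex.degree (σ := Fin m) (∏ i : Fin m, ebar (m + 1) ((i : ℕ) + 2) ^ h i) k =
      if (k : ℕ) = 0 then 2 * Fin.accumulate m m h k else Fin.accumulate m m h k := by
  rw [MonomialOrder.degree_prod fun i _ => pow_ne_zero _ (degree_lex_ebar i).1,
    Finsupp.finsetSum_apply]
  have hterm : ∀ i : Fin m,
      MonomialOrder.lex.degree (σ := Fin m) (ebar (m + 1) ((i : ℕ) + 2) ^ h i) k =
        h i * ((if (k : ℕ) ≤ i then 1 else 0) + if (k : ℕ) = 0 then 1 else 0) := by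
    intro i
    rw [MonomialOrder.degree_pow, Finsupp.smul_apply, smul_eq_mul, (degree_lex_ebar i).2]
  rw [Finset.sum_congr rfl fun i _ => hterm i]
  simp only [Fin.accumulate_apply, Finset.sum_filter]
  split_ifs with hk
  · rw [Finset.mul_sum]
    refine Finset.sum_congr rfl fun i _ => ?_
    simp [hk, mul_comm]
  · simp

/-- for `n ≥ 2`, the map `(h₂,…,hₙ) ↦ ℓexp(ē₂^{h₂}⋯ēₙ^{hₙ})` is
injective, and its image consists exactly of the vectors `(r₁,…,r_{n-1})` such that
`r₁ - 2r₂` is a nonnegative even integer and `rᵢ ≥ r_{i+1}` for `2 ≤ i ≤ n-2`. -/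
theorem stmt16 (n : ℕ) (hn : 2 ≤ n)
    (L : (Fin (n - 1) → ℕ) → (Fin (n - 1) → ℕ))
    (hL : ∀ h : Fin (n - 1) → ℕ,
      IsLeadExp (∏ i : Fin (n - 1), ebar n ((i : ℕ) + 2) ^ h i) (L h)) :
    Function.Injective L ∧
    Set.range L = {r : Fin (n - 1) → ℕ |
      (∃ t : ℕ, rext r 0 = 2 * rext r 1 + 2 * t) ∧
      ∀ i : ℕ, 1 ≤ i → i + 1 ≤ n - 2 → rext r (i + 1) ≤ rext r i} := by
  obtain ⟨m, rfl⟩ : ∃ m, n = m + 1 := ⟨n - 1, by omega⟩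
  have hm : 0 < m := by omega
  change (Fin m → ℕ) → (Fin m → ℕ) at L
  have hLk : ∀ (h : Fin m → ℕ) (k : Fin m), L h k =
      if (k : ℕ) = 0 then 2 * Fin.accumulate m m h k else Fin.accumulate m m h k := by
    intro h k
    rw [← degree_lex_prod_ebar]
    exact (congrFun (hL h).degree_lex_eq k).symm
  have hanti : ∀ (h : Fin m → ℕ), Antitone (Fin.accumulate m m h) := by
    intro h a b hab
    simp only [Fin.accumulate_apply]
    refine Finset.sum_le_sum_of_subset fun i hi => ?_
    have hab' : (a : ℕ) ≤ b := hab
    simp only [Finset.mem_filter, Finset.mem_univ, true_and] at hi ⊢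
    omega
  refine ⟨fun h h' hh => Fin.accumulate_injective le_rfl (funext fun k => ?_), ?_⟩
  · have hk := congrFun hh k
    rw [hLk, hLk] at hk
    change Fin.accumulate m m h k = Fin.accumulate m m h' k
    split_ifs at hk <;> omega
  ext r
  change Fin m → ℕ at r
  constructor
  · rintro ⟨h, rfl⟩
    have hrext : ∀ (i : ℕ) (hi : i < m), rext (L h) i = L h ⟨i, hi⟩ := fun i hi => dif_pos hi
    refine ⟨?_, fun i hi hi' => ?_⟩
    · rw [hrext 0 hm, hLk]
      by_cases h1 : 1 < m
      · have hle := hanti h (show (⟨0, hm⟩ : Fin m) ≤ ⟨1, h1⟩ by simp)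
        rw [hrext 1 h1, hLk]
        refine ⟨Fin.accumulate m m h ⟨0, hm⟩ - Fin.accumulate m m h ⟨1, h1⟩, ?_⟩
        simp only [if_true, one_ne_zero, if_false]
        omega
      · have h0 : rext (L h) 1 = 0 := dif_neg h1
        exact ⟨Fin.accumulate m m h ⟨0, hm⟩, by rw [h0]; simp⟩
    · rw [hrext i (by omega), hrext (i + 1) (by omega), hLk, hLk, if_neg (by simp),
        if_neg (by simp; omega)]
      exact hanti h (by simp)
  · rintro ⟨⟨t, ht⟩, hr⟩
    have hrext : ∀ (i : ℕ) (hi : i < m), rext r i = r ⟨i, hi⟩ := fun i hi => dif_pos hi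
    let s : ℕ → ℕ := fun i => if i = 0 then rext r 1 + t else rext r i
    have hs : Antitone s := by
      refine antitone_nat_of_succ_le fun i => ?_
      rcases Nat.eq_zero_or_pos i with rfl | hi
      · simp [s]
      · have h0 : i ≠ 0 := hi.ne'
        simp only [s, h0, if_false, Nat.succ_ne_zero]
        by_cases him : i + 1 < m
        · exact hr i hi (by omega)
        · have hz : rext r (i + 1) = 0 := dif_neg him
          omega
    refine ⟨Fin.invAccumulate m m fun k => s k, funext fun k => ?_⟩
    rw [hLk, Fin.accumulate_invAccumulate le_rfl fun a b hab => hs hab, ← hrext k k.2]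
    split_ifs with hk
    · simp only [s, hk, if_true]
      omega
    · simp only [s, hk, if_false]
end
end
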